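/- Let p and q be distinct primes with p ≥ 11 and q ≥ 11, and let x, y be nonzero integers with x^p − y^q = 1. Then p < 4·q^2 and q < 4·p^2. -/

import Mathlib

namespace MT

lemma geom_mod (x : ℤ) (p : ℕ) : ∃ W : ℤ, ∑ i ∈ Finset.range p, x ^ i = p + (x - 1) * W := by
  have : (x - 1) ∣ (∑ i ∈ Finset.range p, x ^ i) - p := by
    have h1 : (∑ i ∈ Finset.range p, x ^ i) - (p : ℤ) = ∑ i ∈ Finset.range p, (x ^ i - 1) := by
      simp
    rw [h1]
    exact Finset.dvd_sum fun i _ => sub_one_dvd_pow_sub_one x i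
  obtain ⟨W, hW⟩ := this
  exact ⟨W, by linarith⟩

lemma geom_mod_sq (t : ℤ) (p : ℕ) (hp : Odd p) :
    ∃ s : ℤ, ∑ i ∈ Finset.range p, (1 + p * t) ^ i = p * (1 + p * s) := by
  have key : ∀ n : ℕ, ∃ s : ℤ, (1 + (p : ℤ) * t) ^ n = 1 + n * (p * t) + p ^ 2 * s := by
    intro n
    induction n with
    | zero => exact ⟨0, by simp⟩
    | succ k ih =>
      obtain ⟨s, hs⟩ := ih
      refine ⟨s * (1 + p * t) + k * t ^ 2, ?_⟩
      rw [pow_succ, hs]; push_cast; ring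
  choose s hs using key
  obtain ⟨m, hm⟩ := hp
  have h2 : ∀ n : ℕ, 2 * ∑ i ∈ Finset.range n, (i : ℤ) = n * (n - 1) := by
    intro n
    induction n with
    | zero => simp
    | succ k ih => rw [Finset.sum_range_succ, mul_add, ih]; push_cast; ring
  have h3 : ∑ i ∈ Finset.range p, (i : ℤ) = p * m := by
    have := h2 p
    have hpm : (p : ℤ) = 2 * m + 1 := by exact_mod_cast hm
    have h4 : (p : ℤ) - 1 = 2 * m := by linarith
    rw [h4] at this
    linarith
  refine ⟨t * m + ∑ i ∈ Finset.range p, s i, ?_⟩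
  simp_rw [hs]
  rw [Finset.sum_add_distrib, Finset.sum_add_distrib, ← Finset.sum_mul, h3, ← Finset.mul_sum]
  simp
  ring

lemma one_add_pow_le (s : ℝ) (h0 : 0 ≤ s) (h1 : s ≤ 1) (p : ℕ) : (1 + s) ^ p ≤ 1 + 2 ^ p * s := by
  have key : (1 + s) ^ p ≤ 1 + (2 ^ p - 1) * s := by
    induction p with
    | zero => simp
    | succ k ih =>
      have h2 : (1:ℝ) ≤ 2 ^ k := one_le_pow₀ (by norm_num)
      rw [pow_succ, pow_succ]
      have h3 := mul_le_mul_of_nonneg_right ih (by linarith : 0 ≤ 1 + s)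
      have h4 : ((2:ℝ) ^ k - 1) * s * s ≤ ((2:ℝ) ^ k - 1) * s * 1 :=
        mul_le_mul_of_nonneg_left h1 (mul_nonneg (by linarith) h0)
      linarith
  linarith

lemma cassels_pos (p q : ℕ) (hp : 2 ≤ p) (hq : 2 * p ≤ q) (a y : ℤ) (ha : 1 ≤ a)
    (h : (a ^ q + 1) ^ p - 1 = y ^ q) (hqo : Odd q) : False := by
  have hq0 : q ≠ 0 := by omega
  have hp0 : p ≠ 0 := by omega
  rcases eq_or_lt_of_le ha with h1 | h1
  · subst h1
    have hy : 1 < y := by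
      have : (1:ℤ) ^ q < y ^ q := by
        rw [← h]; norm_num
        have : (2:ℤ) ^ 2 ≤ 2 ^ p := pow_le_pow_right₀ (by norm_num) hp
        linarith
      exact (hqo.strictMono_pow).lt_iff_lt.mp this
    have h2 : (2:ℤ) ^ q ≤ y ^ q := pow_le_pow_left₀ (by norm_num) hy q
    have h3 : (2:ℤ) ^ p ≤ 2 ^ q := pow_le_pow_right₀ (by norm_num) (by omega)
    norm_num at h
    linarith
  · have h2 : (2:ℤ) ^ p ≤ a ^ (q - p) :=
      calc (2:ℤ) ^ p ≤ 2 ^ (q - p) := pow_le_pow_right₀ (by norm_num) (by omega)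
        _ ≤ _ := pow_le_pow_left₀ (by norm_num) h1 _
    have hapos : (0:ℤ) < a := by linarith
    have l1 : (a ^ p) ^ q < y ^ q := by
      rw [← h]
      have : a ^ (q * p) + 1 < (a ^ q + 1) ^ p := by
        have h5 : (0:ℤ) < a ^ q := by positivity
        have := one_add_mul_le_pow (a := (1 : ℤ)) (by norm_num) p
        obtain ⟨k, rfl⟩ : ∃ k, p = k + 2 := ⟨p - 2, by omega⟩
        rw [pow_mul]
        generalize a ^ q = b at *
        have h6 : b ^ (k+1) ≤ (b+1)^(k+1) := pow_le_pow_left₀ h5.le (by linarith) _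
        have h7 : 1 < (b+1)^(k+1) := one_lt_pow₀ (by linarith) (by omega)
        calc b ^ (k+2) + 1 < b^(k+1) * b + (b+1)^(k+1) := by rw [pow_succ]; linarith
          _ ≤ (b+1)^(k+1) * b + (b+1)^(k+1) := by gcongr
          _ = (b+1)^(k+2) := by ring
      rw [← pow_mul, mul_comm p q]
      linarith
    have l2 : y ^ q < (a ^ p + 1) ^ q := by
      rw [← h]
      have e1 : ((a:ℝ) ^ q + 1) ^ p ≤ a ^ (q * p) + 2 ^ p * a ^ (q * (p - 1)) := by
        have hb : (1:ℝ) ≤ (a:ℝ) ^ q := one_le_pow₀ (by exact_mod_cast ha)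
        rw [pow_mul, pow_mul]
        generalize (a:ℝ)^q = b at *
        have := one_add_pow_le b⁻¹ (by positivity) (inv_le_one_of_one_le₀ hb) p
        have hb0 : b ≠ 0 := by positivity
        calc (b+1)^p = b^p * (1 + b⁻¹)^p := by rw [← mul_pow]; congr 1; field_simp
          _ ≤ b^p * (1 + 2^p * b⁻¹) := by gcongr
          _ = b^p + 2 ^ p * b^(p-1) := by
            obtain ⟨k, rfl⟩ : ∃ k, p = k + 1 := ⟨p - 1, by omega⟩
            simp only [Nat.add_sub_cancel]
            field_simp
            ring
      have e1' : (a ^ q + 1) ^ p ≤ a ^ (q * p) + 2 ^ p * a ^ (q * (p - 1)) := by exact_mod_cast e1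
      have e2 : (2:ℤ) ^ p * a ^ (q * (p - 1)) ≤ (a ^ p) ^ (q - 1) := by
        calc (2:ℤ) ^ p * a ^ (q * (p - 1)) ≤ a ^ (q - p) * a ^ (q * (p - 1)) := by gcongr
          _ = (a ^ p) ^ (q - 1) := by
            rw [← pow_add, ← pow_mul]; congr 1
            obtain ⟨k, rfl⟩ : ∃ k, p = k + 1 := ⟨p - 1, by omega⟩
            obtain ⟨l, rfl⟩ : ∃ l, q = l + (k + 1) := ⟨q - (k+1), by omega⟩
            simp only [Nat.add_sub_cancel]
            rw [show l + (k+1) - 1 = l + k by omega]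
            ring
      have e3 : (a ^ p) ^ q + (a ^ p) ^ (q - 1) ≤ (a ^ p + 1) ^ q := by
        have hb : 0 < a ^ p := by positivity
        generalize a ^ p = b at *
        obtain ⟨l, rfl⟩ : ∃ l, q = l + 1 := ⟨q - 1, by omega⟩
        simp only [Nat.add_sub_cancel]
        calc b ^ (l+1) + b ^ l = b ^ l * (b + 1) := by ring
          _ ≤ (b+1)^l * (b+1) := by gcongr; linarith
          _ = _ := by ring
      have e4 : a ^ (q * p) = (a ^ p) ^ q := by rw [← pow_mul, mul_comm]
      linarith
    have m1 := (hqo.strictMono_pow).lt_iff_lt.mp l1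
    have m2 := (hqo.strictMono_pow).lt_iff_lt.mp l2
    linarith [Int.add_one_le_iff.mpr m1]

lemma cassels_neg (p q : ℕ) (hp : 2 ≤ p) (hq : 2 * p ≤ q) (b y : ℤ) (hb : 2 ≤ b)
    (h : (b ^ q - 1) ^ p + 1 = y ^ q) (hqo : Odd q) : False := by
  have hbp : 0 < b := by linarith
  have hbq : 2 ≤ b ^ q := le_trans hb (le_self_pow₀ (by linarith) (by omega))
  have hbpp : 2 ≤ b ^ p := le_trans hb (le_self_pow₀ (by linarith) (by omega))
  have l1 : y ^ q < (b ^ p) ^ q := by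
    rw [← h, ← pow_mul, mul_comm p q, pow_mul]
    generalize b ^ q = c at *
    obtain ⟨k, rfl⟩ : ∃ k, p = k + 2 := ⟨p - 2, by omega⟩
    have h6 : (c-1) ^ (k+1) ≤ c^(k+1) := pow_le_pow_left₀ (by linarith) (by linarith) _
    have h7 : 1 < c^(k+1) := one_lt_pow₀ (by linarith) (by omega)
    calc (c-1)^(k+2) + 1 < (c-1)^(k+1) * (c-1) + c^(k+1) := by rw [pow_succ]; linarith
      _ ≤ c^(k+1) * (c-1) + c^(k+1) := by gcongr; linarith
      _ = c^(k+2) := by ring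
  have l2 : (b ^ p - 1) ^ q < y ^ q := by
    rw [← h]
    have e1 : b ^ (q * p) - p * b ^ (q * (p - 1)) ≤ (b ^ q - 1) ^ p := by
      rw [pow_mul, pow_mul]
      generalize b ^ q = c at *
      have hc : (2:ℝ) ≤ c := by exact_mod_cast hbq
      have hc1 : (c:ℝ)⁻¹ ≤ 1 := inv_le_one_of_one_le₀ (by linarith)
      have := one_add_mul_le_pow (a := -(c:ℝ)⁻¹) (by linarith) p
      have hc0 : (c:ℝ) ≠ 0 := by positivity
      have e : (c:ℝ)^p - p * (c:ℝ)^(p-1) ≤ (c - 1 : ℝ)^p := by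
        calc (c:ℝ)^p - p * (c:ℝ)^(p-1) = c^p * (1 + p * -(c:ℝ)⁻¹) := by
              obtain ⟨k, rfl⟩ : ∃ k, p = k + 1 := ⟨p - 1, by omega⟩
              simp only [Nat.add_sub_cancel]
              field_simp
              ring
          _ ≤ c^p * (1 + -(c:ℝ)⁻¹)^p := by gcongr
          _ = _ := by rw [← mul_pow]; congr 1; field_simp; ring
      exact_mod_cast e
    have e2 : (p:ℤ) * b ^ (q * (p - 1)) ≤ (b ^ p) ^ (q - 1) := by
      have : (p:ℤ) ≤ b ^ (q - p) := by
        calc (p:ℤ) ≤ 2 ^ p := by exact_mod_cast (Nat.lt_two_pow_self).le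
          _ ≤ 2 ^ (q - p) := pow_le_pow_right₀ (by norm_num) (by omega)
          _ ≤ _ := pow_le_pow_left₀ (by norm_num) hb _
      calc (p:ℤ) * b ^ (q * (p - 1)) ≤ b ^ (q - p) * b ^ (q * (p - 1)) := by gcongr
        _ = (b ^ p) ^ (q - 1) := by
          rw [← pow_add, ← pow_mul]; congr 1
          obtain ⟨k, rfl⟩ : ∃ k, p = k + 1 := ⟨p - 1, by omega⟩
          obtain ⟨l, rfl⟩ : ∃ l, q = l + (k + 1) := ⟨q - (k+1), by omega⟩
          simp only [Nat.add_sub_cancel]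
          rw [show l + (k+1) - 1 = l + k by omega]
          ring
    have e3 : (b ^ p - 1) ^ q ≤ (b ^ p) ^ q - (b ^ p) ^ (q - 1) := by
      generalize b ^ p = c at *
      obtain ⟨l, rfl⟩ : ∃ l, q = l + 1 := ⟨q - 1, by omega⟩
      simp only [Nat.add_sub_cancel]
      calc (c-1)^(l+1) = (c-1)^l * (c-1) := by ring
        _ ≤ c^l * (c-1) := by gcongr <;> linarith
        _ = _ := by ring
    have e4 : b ^ (q * p) = (b ^ p) ^ q := by rw [← pow_mul, mul_comm]
    linarith
  have m1 := (hqo.strictMono_pow).lt_iff_lt.mp l1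
  have m2 := (hqo.strictMono_pow).lt_iff_lt.mp l2
  linarith [Int.add_one_le_iff.mpr m2]

lemma cassels (p q : ℕ) (hp : p.Prime) (hq : q.Prime) (hp11 : 11 ≤ p) (hpq : 4 * p ^ 2 ≤ q)
    (x y : ℤ) (hx : x ≠ 0) (hy : y ≠ 0) (h : x ^ p - y ^ q = 1) :
    ∃ v : ℤ, 0 < v ∧ ∑ i ∈ Finset.range p, x ^ i = p * v ^ q ∧ IsCoprime (p : ℤ) v ∧
      (p : ℤ) ^ (q - 1) ∣ x - 1 ∧ x ≠ 1 := by
  have hpo : Odd p := hp.odd_of_ne_two (by omega)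
  have hq2p : 2 * p ≤ q := by nlinarith
  have hqo : Odd q := hq.odd_of_ne_two (by omega)
  have hx1 : x ≠ 1 := by
    rintro rfl
    simp only [one_pow] at h
    have : y ^ q = 0 := by linarith
    exact hy (pow_eq_zero_iff (by omega) |>.mp this)
  set Φ := ∑ i ∈ Finset.range p, x ^ i with hΦ
  have hmul : (x - 1) * Φ = y ^ q := by
    rw [hΦ, mul_geom_sum]; linarith
  have hpI : Prime (p : ℤ) := Nat.prime_iff_prime_int.mp hp
  obtain ⟨W, hW⟩ := geom_mod x p
  by_cases hpx : (p : ℤ) ∣ x - 1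
  · obtain ⟨t, ht⟩ := hpx
    have hxt : x = 1 + p * t := by linarith
    obtain ⟨s, hs⟩ := geom_mod_sq t p hpo
    rw [← hxt, ← hΦ] at hs
    have hp0 : (p : ℤ) ≠ 0 := by exact_mod_cast hp.ne_zero
    have h1 : 1 + p * s = 1 + t * W := by
      apply mul_left_cancel₀ hp0
      rw [← hs, hΦ, hW, ht]; ring
    have c1 : IsCoprime (p : ℤ) (1 + p * s) := ⟨-s, 1, by ring⟩
    have c2 : IsCoprime t (1 + p * s) := by rw [h1]; exact ⟨-W, 1, by ring⟩
    have c3 : IsCoprime (p * (x - 1)) (1 + p * s) := by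
      rw [ht]; exact c1.mul_left (c1.mul_left c2)
    have hm2 : (p * (x - 1)) * (1 + p * s) = y ^ q := by
      rw [← hmul, hs]; ring
    obtain ⟨w, hw⟩ := Int.eq_pow_of_mul_eq_pow_odd_left c3 hqo hm2
    obtain ⟨v, hv⟩ := Int.eq_pow_of_mul_eq_pow_odd_right c3 hqo hm2
    have hΦpos : 0 < Φ := hpo.geom_sum_pos
    refine ⟨v, ?_, ?_, ?_, ?_, hx1⟩
    · have : 0 < v ^ q := by
        rw [← hv]
        rw [hs] at hΦpos
        exact pos_of_mul_pos_right hΦpos (by positivity)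
      exact (hqo.pow_pos_iff).mp this
    · rw [hs, hv]
    · rw [hv] at c1
      exact (IsCoprime.pow_right_iff (by omega)).mp c1
    · have : (p : ℤ) ∣ w := hpI.dvd_of_dvd_pow (n := q) (by rw [← hw]; exact dvd_mul_right _ _)
      have h3 := pow_dvd_pow_of_dvd this q
      rw [← hw] at h3
      obtain ⟨l, rfl⟩ : ∃ l, q = l + 1 := ⟨q - 1, by omega⟩
      rw [pow_succ', mul_dvd_mul_iff_left hp0] at h3
      simpa using h3
  · exfalso
    have c1 : IsCoprime (x - 1) (p : ℤ) := (hpI.coprime_iff_not_dvd.mpr hpx).symm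
    have c2 : IsCoprime (x - 1) Φ := by
      rw [hΦ, hW]
      obtain ⟨a, b, hab⟩ := c1
      exact ⟨a - b * W, b, by linear_combination hab⟩
    obtain ⟨a, ha⟩ := Int.eq_pow_of_mul_eq_pow_odd_left c2 hqo hmul
    rcases lt_trichotomy a 0 with h0 | h0 | h0
    · by_cases h2 : a = -1
      · subst h2; rw [hqo.neg_one_pow] at ha; apply hx; linarith
      refine cassels_neg p q hp.two_le hq2p (-a) (-y) (by omega) ?_ hqo
      rw [hqo.neg_pow, hqo.neg_pow, ← ha, show -(x-1) - 1 = -x by ring, hpo.neg_pow]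
      linarith
    · subst h0; rw [zero_pow (by omega)] at ha; apply hx1; linarith
    · refine cassels_pos p q hp.two_le hq2p a y h0 ?_ hqo
      rw [← ha, ← h]; ring

end MT

namespace MT

/-- the index sets coming from Jacobi sums -/
def TT (p : ℕ) [NeZero p] (i j : ZMod p) : Finset (ZMod p)ˣ :=
  Finset.univ.filter (fun c => ((c : ZMod p) * i).val + ((c : ZMod p) * j).val < p)

lemma mem_TT {p : ℕ} [NeZero p] {i j : ZMod p} {c : (ZMod p)ˣ} :
    c ∈ TT p i j ↔ ((c : ZMod p) * i).val + ((c : ZMod p) * j).val < p := by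
  simp [TT]

lemma TT_neg {p : ℕ} [Fact p.Prime] {i j : ZMod p} (hi : i ≠ 0) (hj : j ≠ 0) (hij : i + j ≠ 0)
    (c : (ZMod p)ˣ) : c ∈ TT p i j ↔ -c ∉ TT p i j := by
  rw [mem_TT, mem_TT]
  have h1 : (c : ZMod p) * i ≠ 0 := mul_ne_zero c.ne_zero hi
  have h2 : (c : ZMod p) * j ≠ 0 := mul_ne_zero c.ne_zero hj
  have h3 : (c : ZMod p) * i + c * j ≠ 0 := by rw [← mul_add]; exact mul_ne_zero c.ne_zero hij
  rw [Units.val_neg, neg_mul, neg_mul]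
  generalize (c : ZMod p) * i = a at *
  generalize (c : ZMod p) * j = b at *
  have : NeZero a := ⟨h1⟩
  have : NeZero b := ⟨h2⟩
  rw [ZMod.val_neg_of_ne_zero, ZMod.val_neg_of_ne_zero]
  have ha := ZMod.val_lt a
  have hb := ZMod.val_lt b
  have hne : a.val + b.val ≠ p := by
    intro h
    apply h3
    have : ((a.val + b.val : ℕ) : ZMod p) = 0 := by rw [h]; simp
    simpa using this
  omega

lemma mem_TT_neg {p : ℕ} [Fact p.Prime] {m : ℕ} (hm : 2 ≤ m) (hmp : m < p) (c : (ZMod p)ˣ) :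
    c ∈ TT p (-1) (-((m - 1 : ℕ) : ZMod p)) ↔
      p < (c : ZMod p).val + ((m - 1) * (c : ZMod p).val) % p := by
  rw [mem_TT, mul_neg, mul_neg, mul_one]
  have hm0 : ((m - 1 : ℕ) : ZMod p) ≠ 0 := by
    rw [Ne, ZMod.natCast_eq_zero_iff]
    intro h; have := Nat.le_of_dvd (by omega) h; omega
  have h2 : (c : ZMod p) * ((m - 1 : ℕ) : ZMod p) ≠ 0 := mul_ne_zero c.ne_zero hm0
  have : NeZero ((c : ZMod p)) := ⟨c.ne_zero⟩
  have : NeZero ((c : ZMod p) * ((m - 1 : ℕ) : ZMod p)) := ⟨h2⟩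
  rw [ZMod.val_neg_of_ne_zero, ZMod.val_neg_of_ne_zero]
  have e : ((c : ZMod p) * ((m - 1 : ℕ) : ZMod p)).val = ((m - 1) * (c : ZMod p).val) % p := by
    rw [ZMod.val_mul, ZMod.val_natCast, mul_comm]
    simp
  rw [e]
  have ha := ZMod.val_lt (c : ZMod p)
  have hb : ((m - 1) * (c : ZMod p).val) % p < p := Nat.mod_lt _ (by omega)
  omega

lemma pos_data (p j : ℕ) (hp : p.Prime) (hp11 : 11 ≤ p) (hj : 2 ≤ j)
    (h : j * (j - 1) ≤ p ∨ 2 * j = p + 1) :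
    ∃ m, 2 ≤ m ∧ m < p ∧ m * (j - 1) < p ∧ (m - 1) * j < p ∧ p < m * j := by
  have hjp : j < p := by
    rcases h with h | h
    · by_contra hc
      push Not at hc
      have : p * (p - 1) ≤ j * (j - 1) := Nat.mul_le_mul hc (by omega)
      have : p * 2 ≤ p * (p - 1) := Nat.mul_le_mul le_rfl (by omega)
      omega
    · omega
  have hnd : ¬ j ∣ p := by
    intro hd
    rcases (Nat.dvd_prime hp).mp hd with h | h <;> omega
  have hmod : 0 < p % j := Nat.pos_of_ne_zero fun h => hnd (Nat.dvd_of_mod_eq_zero h)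
  have hdm := Nat.div_add_mod p j
  have hml : p % j < j := Nat.mod_lt _ (by omega)
  have hd1 : 1 ≤ p / j := (Nat.one_le_div_iff (by omega)).mpr hjp.le
  refine ⟨p / j + 1, by omega, ?_, ?_, ?_, ?_⟩
  · have : p / j ≤ p / 2 := Nat.div_le_div_left hj (by omega)
    omega
  · obtain ⟨i, rfl⟩ : ∃ i, j = i + 1 := ⟨j - 1, by omega⟩
    simp only [Nat.add_sub_cancel] at *
    rcases h with h | h
    · have : i ≤ p / (i + 1) := by
        rw [Nat.le_div_iff_mul_le (by omega)]; nlinarith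
      nlinarith
    · have : p / (i + 1) = 1 := by
        apply Nat.div_eq_of_lt_le <;> omega
      rw [this]; omega
  · rw [Nat.add_sub_cancel]; nlinarith
  · nlinarith

lemma base_ineq (J : ℕ) (hJ : 4 ≤ J) :
    13 * ((J - 1) ^ 2 * (J + 2) ^ 2) ≤ 3 * (J + 12).choose 12 := by
  induction J, hJ using Nat.le_induction with
  | base => decide
  | succ J hJ ih =>
    have h1 := Nat.choose_mul_succ_eq (J + 12) 12
    rw [show J + 12 + 1 - 12 = J + 1 by omega] at h1
    rw [show J + 1 + 12 = J + 12 + 1 by ring, Nat.add_sub_cancel]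
    have h2 : (J + 1) * (J ^ 2 * (J + 3) ^ 2) ≤ (J + 13) * ((J - 1) ^ 2 * (J + 2) ^ 2) := by
      obtain ⟨u, rfl⟩ : ∃ u, J = u + 4 := ⟨J - 4, by omega⟩
      rw [show u + 4 - 1 = u + 3 by omega]
      ring_nf
      nlinarith [sq_nonneg u, sq_nonneg (u^2), Nat.zero_le (u^3), Nat.zero_le (u^4), Nat.zero_le u]
    have h3 : (J + 1) * (13 * (J ^ 2 * (J + 1 + 2) ^ 2)) ≤
        (J + 1) * (3 * (J + 12 + 1).choose 12) := by
      nlinarith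
    exact Nat.le_of_mul_le_mul_left h3 (by omega)

lemma count_ineq (J k B : ℕ) (hJ : 1 ≤ J) (hk : 12 ≤ k) (h : 13 * B ≤ 3 * (J + 12).choose 12) :
    (k + 1) * B ≤ 3 * (J + k).choose k := by
  induction k, hk using Nat.le_induction with
  | base => exact h
  | succ k hk ih =>
    have h1 : (J + k + 1).choose (k + 1) * (k + 1) = (J + k + 1) * (J + k).choose k := by
      rw [← Nat.add_one_mul_choose_eq]
    have h3 : (k + 1) * ((k + 1 + 1) * B) ≤ (k + 1) * (3 * (J + (k + 1)).choose (k + 1)) := by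
      rw [← add_assoc]
      have : (k + 2) * ((k + 1) * B) ≤ (J + k + 1) * (3 * (J + k).choose k) :=
        Nat.mul_le_mul (by omega) ih
      nlinarith
    exact Nat.le_of_mul_le_mul_left h3 (by omega)

lemma exists_J (p : ℕ) (hp11 : 11 ≤ p) : ∃ J, 3 ≤ J ∧ J * (J - 1) ≤ p ∧ p < (J + 1) * J := by
  have hex : ∃ J, p < (J + 1) * J := ⟨p, by nlinarith⟩
  classical
  refine ⟨Nat.find hex, ?_, ?_, Nat.find_spec hex⟩
  · by_contra hc
    have := Nat.find_spec hex
    push Not at hc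
    have h2 : Nat.find hex ≤ 2 := by omega
    nlinarith
  · have h3 : Nat.find hex ≠ 0 := by
      intro h0
      have := Nat.find_spec hex
      rw [h0] at this; simp at this
    have := Nat.find_min hex (m := Nat.find hex - 1) (by omega)
    push Not at this
    rwa [Nat.sub_add_cancel (by omega)] at this

lemma family (p : ℕ) [hpf : Fact p.Prime] (hp11 : 11 ≤ p) :
    ∃ (n : ℕ) (I K : Fin n → ZMod p) (pos : Fin n → (ZMod p)ˣ),
      (∀ s, I s ≠ 0 ∧ K s ≠ 0 ∧ I s + K s ≠ 0) ∧
      (∀ s, pos s ∈ TT p (I s) (K s)) ∧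
      (∀ s t, s < t → pos s ∉ TT p (I t) (K t)) ∧
      (∀ k, 12 ≤ k → (k + 1) * (p - 1) ^ 2 ≤ 3 * (n + k - 1).choose k) := by
  have hp := hpf.out
  obtain ⟨J, hJ3, hJ1, hJ2⟩ := exists_J p hp11
  have hJp : 2 * J < p := by
    rcases eq_or_lt_of_le hJ3 with h | h
    · omega
    · have : 3 ≤ J - 1 := by omega
      have : J * 3 ≤ J * (J - 1) := Nat.mul_le_mul le_rfl this
      omega
  have hodd : Odd p := hp.odd_of_ne_two (by omega)
  -- positions
  let P : Fin (J + 1) → ℕ := fun s => if (s : ℕ) = J then (p + 1) / 2 else s + 1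
  have hP1 : ∀ s, 1 ≤ P s := by intro s; simp only [P]; split_ifs <;> omega
  have hPp : ∀ s, P s < p := by intro s; simp only [P]; split_ifs <;> omega
  have hPmono : ∀ s t, s < t → P s < P t := by
    intro s t hst
    have := s.2; have := t.2
    simp only [P]; rw [Fin.lt_def] at hst; split_ifs <;> omega
  have hP2 : ∀ s, 2 ≤ P s → (P s * (P s - 1) ≤ p ∨ 2 * P s = p + 1) := by
    intro s _
    simp only [P]
    obtain ⟨r, hr⟩ := hodd
    split_ifs with h
    · right; omega
    · left
      have := s.2
      calc ((s:ℕ) + 1) * ((s:ℕ) + 1 - 1) ≤ J * (J - 1) := Nat.mul_le_mul (by omega) (by omega)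
        _ ≤ p := hJ1
  have hcop : ∀ s, (P s).Coprime p := fun s =>
    (Nat.coprime_of_lt_prime (by have := hP1 s; omega) (hPp s) hp).symm
  have key : ∀ s, ∃ i k : ZMod p, (i ≠ 0 ∧ k ≠ 0 ∧ i + k ≠ 0) ∧
      ∀ c : (ZMod p)ˣ, ((c : ZMod p).val = P s → c ∈ TT p i k) ∧
        ((c : ZMod p).val < P s → c ∉ TT p i k) := by
    intro s
    by_cases h1 : P s = 1
    · have h2 : (2 : ZMod p) ≠ 0 := by
        have : ((2 : ℕ) : ZMod p) ≠ 0 := by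
          rw [Ne, ZMod.natCast_eq_zero_iff]
          intro h; have := Nat.le_of_dvd (by omega) h; omega
        simpa using this
      refine ⟨1, 1, ⟨one_ne_zero, one_ne_zero, by rw [one_add_one_eq_two]; exact h2⟩, ?_⟩
      intro c
      rw [mem_TT, mul_one, h1]
      constructor
      · intro h; omega
      · intro h
        have : (c : ZMod p).val ≠ 0 := by
          rw [Ne, ZMod.val_eq_zero]; exact c.ne_zero
        omega
    · have h2 : 2 ≤ P s := by have := hP1 s; omega
      obtain ⟨m, hm2, hmp, ha, hb, hc⟩ := pos_data p (P s) hp hp11 h2 (hP2 s h2)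
      have hm0 : ((m - 1 : ℕ) : ZMod p) ≠ 0 := by
        rw [Ne, ZMod.natCast_eq_zero_iff]
        intro h; have := Nat.le_of_dvd (by omega) h; omega
      have hm1 : (m : ZMod p) ≠ 0 := by
        rw [Ne, ZMod.natCast_eq_zero_iff]
        intro h; have := Nat.le_of_dvd (by omega) h; omega
      refine ⟨-1, -((m - 1 : ℕ) : ZMod p), ⟨by simp, by simpa using hm0, ?_⟩, ?_⟩
      · rw [← neg_add, neg_ne_zero, Nat.cast_sub (by omega)]
        simpa using hm1
      · intro c
        rw [mem_TT_neg hm2 hmp]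
        obtain ⟨l, rfl⟩ : ∃ l, m = l + 1 := ⟨m - 1, by omega⟩
        simp only [Nat.add_sub_cancel] at *
        constructor
        · intro h
          rw [h, Nat.mod_eq_of_lt hb]
          nlinarith
        · intro h
          have : (l + 1) * (c : ZMod p).val < p := lt_of_le_of_lt
            (Nat.mul_le_mul le_rfl (by omega)) ha
          rw [Nat.mod_eq_of_lt (by nlinarith)]
          nlinarith
  choose I K hIK hT using key
  have hval : ∀ s, ((ZMod.unitOfCoprime (P s) (hcop s) : (ZMod p)ˣ) : ZMod p).val = P s := by
    intro s
    rw [ZMod.coe_unitOfCoprime, ZMod.val_natCast, Nat.mod_eq_of_lt (hPp s)]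
  refine ⟨J + 1, I, K, fun s => ZMod.unitOfCoprime (P s) (hcop s), hIK, ?_, ?_, ?_⟩
  · intro s; exact (hT s _).1 (hval s)
  · intro s t hst
    exact (hT t _).2 (by rw [hval]; exact hPmono s t hst)
  · intro k hk
    rw [show J + 1 + k - 1 = J + k by omega]
    apply count_ineq J k _ (by omega) hk
    rcases eq_or_lt_of_le hJ3 with h | h
    · subst h
      have : p - 1 ≤ 10 := by omega
      calc 13 * (p - 1) ^ 2 ≤ 13 * 10 ^ 2 := by gcongr
        _ ≤ _ := by decide
    · refine le_trans ?_ (base_ineq J h)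
      rw [← mul_pow]
      gcongr
      obtain ⟨u, rfl⟩ : ∃ u, J = u + 1 := ⟨J - 1, by omega⟩
      simp only [Nat.add_sub_cancel]
      have : p - 1 + 2 ≤ (u + 1 + 1) * (u + 1) := by omega
      nlinarith

lemma family_inj {ι : Type*} [Fintype ι] [DecidableEq ι] {n : ℕ} (T : Fin n → Finset ι) (pos : Fin n → ι)
    (h1 : ∀ s, pos s ∈ T s) (h2 : ∀ s t, s < t → pos s ∉ T t) (f g : Fin n → ℕ)
    (h : ∀ c, ∑ s, (if c ∈ T s then f s else 0) = ∑ s, (if c ∈ T s then g s else 0)) : f = g := by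
  funext s
  induction s using WellFoundedLT.induction with
  | _ s ih =>
    have hs := h (pos s)
    rw [← Finset.add_sum_erase _ _ (Finset.mem_univ s),
      ← Finset.add_sum_erase _ _ (Finset.mem_univ s)] at hs
    have e : ∑ t ∈ Finset.univ.erase s, (if pos s ∈ T t then f t else 0) =
        ∑ t ∈ Finset.univ.erase s, (if pos s ∈ T t then g t else 0) := by
      refine Finset.sum_congr rfl fun t ht => ?_
      rcases lt_trichotomy t s with hts | hts | hts
      · rw [ih t hts]
      · exact absurd hts (Finset.ne_of_mem_erase ht)
      · rw [if_neg (h2 s t hts), if_neg (h2 s t hts)]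
    rw [e, if_pos (h1 s), if_pos (h1 s)] at hs
    exact Nat.add_right_cancel hs

end MT

namespace MT
open NumberField Pointwise

section
variable (p : ℕ) [Fact p.Prime] (K : Type*) [Field K] [NumberField K] [IsCyclotomicExtension {p} ℚ K]

/-- Galois automorphism attached to a unit mod p -/
noncomputable def gal : (ZMod p)ˣ →* Gal(K/ℚ) :=
  (IsCyclotomicExtension.Rat.galEquivZMod p K).symm.toMonoidHom

variable {p K}

lemma gal_bij : Function.Bijective (gal p K) :=
  (IsCyclotomicExtension.Rat.galEquivZMod p K).symm.bijective

lemma gal_smul (c : (ZMod p)ˣ) {z : 𝓞 K} (hz : z ^ p = 1) :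
    gal p K c • z = z ^ (c : ZMod p).val := by
  rw [IsCyclotomicExtension.Rat.galEquivZMod_smul_of_pow_eq p K _ hz]
  have h : IsCyclotomicExtension.Rat.galEquivZMod p K (gal p K c) = c :=
    MulEquiv.apply_symm_apply _ c
  rw [h]

lemma gal_apply (c : (ZMod p)ˣ) {z : K} (hz : z ^ p = 1) :
    gal p K c z = z ^ (c : ZMod p).val := by
  rw [IsCyclotomicExtension.Rat.galEquivZMod_apply_of_pow_eq p K _ hz]
  have h : IsCyclotomicExtension.Rat.galEquivZMod p K (gal p K c) = c :=
    MulEquiv.apply_symm_apply _ c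
  rw [h]

lemma smul_intCast' (g : Gal(K/ℚ)) (n : ℤ) : g • (n : 𝓞 K) = n := by
  exact map_intCast (MulSemiringAction.toRingHom Gal(K/ℚ) (𝓞 K) g) n

lemma smul_natCast' (g : Gal(K/ℚ)) (n : ℕ) : g • (n : 𝓞 K) = n := by
  exact map_natCast (MulSemiringAction.toRingHom Gal(K/ℚ) (𝓞 K) g) n

lemma absNorm_smul (g : Gal(K/ℚ)) (P : Ideal (𝓞 K)) :
    Ideal.absNorm (g • P) = Ideal.absNorm P := by
  rw [Ideal.absNorm_apply, Ideal.absNorm_apply, Submodule.cardQuot_apply, Submodule.cardQuot_apply]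
  refine (Nat.card_congr (Ideal.quotientEquiv P (g • P)
    (MulSemiringAction.toRingEquiv Gal(K/ℚ) (𝓞 K) g) ?_).toEquiv).symm
  rw [Ideal.pointwise_smul_def]
  rfl

lemma smul_prod'' {ι : Type*} (g : Gal(K/ℚ)) (s : Finset ι) (f : ι → 𝓞 K) :
    g • (∏ i ∈ s, f i) = ∏ i ∈ s, g • f i :=
  map_prod (MulSemiringAction.toRingHom Gal(K/ℚ) (𝓞 K) g) f s

lemma smul_span (g : Gal(K/ℚ)) (a : 𝓞 K) :
    g • (Ideal.span {a}) = Ideal.span {g • a} := by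
  rw [Ideal.pointwise_smul_def, Ideal.map_span]
  simp

lemma TT_card {i j : ZMod p} (hi : i ≠ 0) (hj : j ≠ 0) (hij : i + j ≠ 0) :
    2 * (TT p i j).card = p - 1 := by
  have h1 : (TT p i j).card = (TT p i j)ᶜ.card := by
    refine Finset.card_bij (fun c _ => -c) ?_ ?_ ?_
    · intro c hc
      rw [Finset.mem_compl]
      exact (TT_neg hi hj hij c).1 hc
    · intro a _ b _ h
      exact neg_injective h
    · intro b hb
      refine ⟨-b, ?_, neg_neg b⟩
      rw [TT_neg hi hj hij, neg_neg]
      exact Finset.mem_compl.1 hb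
  have h2 := Finset.card_add_card_compl (TT p i j)
  rw [ZMod.card_units_eq_totient, Nat.totient_prime Fact.out] at h2
  omega

lemma TT_compl_prod {M : Type*} [CommMonoid M] {i j : ZMod p} (hi : i ≠ 0) (hj : j ≠ 0)
    (hij : i + j ≠ 0) (f : (ZMod p)ˣ → M) :
    (∏ c ∈ TT p i j, f c) * (∏ c ∈ TT p i j, f (-c)) = ∏ c, f c := by
  rw [← Finset.prod_mul_prod_compl (TT p i j)]
  congr 1
  refine Finset.prod_bij (fun c _ => -c) ?_ ?_ ?_ ?_
  · intro c hc
    rw [Finset.mem_compl]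
    exact (TT_neg hi hj hij c).1 hc
  · intro a _ b _ h
    exact neg_injective h
  · intro b hb
    refine ⟨-b, ?_, neg_neg b⟩
    rw [TT_neg hi hj hij, neg_neg]
    exact Finset.mem_compl.1 hb
  · intro a _; rfl

end
end MT

namespace MT
open NumberField Pointwise

lemma exists_char {F R : Type*} [Field F] [Fintype F] [CommRing R] [IsDomain R] {p : ℕ}
    (hp : p.Prime) (f : R →+* F) {ζ : R} (hζ : IsPrimitiveRoot ζ p)
    (hf : IsPrimitiveRoot (f ζ) p) :
    ∃ χ : MulChar F R, ∃ n0 : ℕ, p * n0 = Fintype.card F - 1 ∧ 0 < n0 ∧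
      (∀ t, t ≠ 0 → χ t ^ p = 1) ∧ (∀ t, f (χ t) = t ^ n0) ∧
      (∀ a : ℕ, ¬ p ∣ a → χ ^ a ≠ 1) := by
  classical
  have hfz : f ζ ≠ 0 := hf.ne_zero hp.ne_zero
  have hcard : 1 < Fintype.card F := Fintype.one_lt_card
  obtain ⟨n0, hn0⟩ : p ∣ Fintype.card F - 1 := by
    apply hf.dvd_of_pow_eq_one
    exact FiniteField.pow_card_sub_one_eq_one _ hfz
  have hn0pos : 0 < n0 := by
    rcases Nat.eq_zero_or_pos n0 with h | h
    · subst h; omega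
    · exact h
  have hk : ∀ u : Fˣ, ∃ k : ℕ, f (ζ ^ k) = (u : F) ^ n0 := by
    intro u
    have : ((u : F) ^ n0) ^ p = 1 := by
      rw [← pow_mul, mul_comm, ← hn0]
      exact FiniteField.pow_card_sub_one_eq_one _ u.ne_zero
    have hnz : NeZero p := ⟨hp.ne_zero⟩
    obtain ⟨i, _, hi⟩ := hf.eq_pow_of_pow_eq_one this
    exact ⟨i, by rw [map_pow, hi]⟩
  choose k hk using hk
  have hinj : ∀ a b : ℕ, f (ζ ^ a) = f (ζ ^ b) → ζ ^ a = ζ ^ b := by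
    intro a b h
    rw [map_pow, map_pow] at h
    have e : a ≡ b [MOD p] := by
      have := (hf.isUnit_unit hp.ne_zero)
      have e2 : (hf.isUnit hp.ne_zero).unit ^ a = (hf.isUnit hp.ne_zero).unit ^ b := by
        ext; simpa using h
      rw [pow_eq_pow_iff_modEq, ← this.eq_orderOf] at e2
      exact e2
    rw [← Nat.mod_add_div a p, ← Nat.mod_add_div b p, pow_add, pow_add, pow_mul, pow_mul,
      hζ.pow_eq_one, one_pow, one_pow, e]
  have hu := hζ.isUnit hp.ne_zero
  let φ : Fˣ →* Rˣ :=
    { toFun := fun u => hu.unit ^ k u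
      map_one' := by
        ext
        have := hinj (k 1) 0 (by rw [hk]; simp)
        simpa using this
      map_mul' := by
        intro a b
        ext
        have := hinj (k (a * b)) (k a + k b) (by rw [hk, pow_add, map_mul, hk, hk]; simp [mul_pow])
        simpa [pow_add] using this }
  have hφ : ∀ u : Fˣ, MulChar.ofUnitHom φ u = ζ ^ k u := by
    intro u
    rw [MulChar.ofUnitHom_coe]
    simp [φ]
  refine ⟨MulChar.ofUnitHom φ, n0, hn0.symm, hn0pos, ?_, ?_, ?_⟩
  · intro t ht
    rw [show t = ((Units.mk0 t ht : Fˣ) : F) from rfl, hφ, ← pow_mul, mul_comm, pow_mul,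
      hζ.pow_eq_one, one_pow]
  · intro t
    by_cases ht : t = 0
    · subst ht
      rw [MulChar.map_zero, map_zero, zero_pow hn0pos.ne']
    · rw [show t = ((Units.mk0 t ht : Fˣ) : F) from rfl, hφ, hk]
  · intro a ha h
    obtain ⟨g, hg⟩ := IsCyclic.exists_ofOrder_eq_natCard (α := Fˣ)
    apply ha
    have h1 : (MulChar.ofUnitHom φ ^ a) (g : F) = 1 := by
      rw [h, MulChar.one_apply_coe]
    rw [MulChar.pow_apply_coe, hφ] at h1
    have h2 := congrArg f h1
    rw [map_pow, hk, map_one, ← pow_mul] at h2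
    have h3 : g ^ (n0 * a) = 1 := by ext; simpa using h2
    have h4 := orderOf_dvd_of_pow_eq_one h3
    rw [hg, Nat.card_units, Nat.card_eq_fintype_card, hn0, mul_comm p] at h4
    exact Nat.dvd_of_mul_dvd_mul_left hn0pos h4

lemma sum_zero {F : Type*} [Field F] [Fintype F] (a b : ℕ)
    (h : a + b < Fintype.card F - 1) : ∑ t : F, t ^ a * (1 - t) ^ b = 0 := by
  classical
  let P : Polynomial F := Polynomial.X ^ a * (1 - Polynomial.X) ^ b
  have hdeg : P.natDegree < a + b + 1 := by
    have h1 : ((1 - Polynomial.X : Polynomial F)).natDegree ≤ 1 := by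
      refine (Polynomial.natDegree_sub_le _ _).trans ?_
      simp
    have h2 : P.natDegree ≤ a + b * 1 := by
      refine Polynomial.natDegree_mul_le.trans ?_
      refine add_le_add (by simp) ?_
      exact Polynomial.natDegree_pow_le_of_le b h1
    omega
  have : ∀ t : F, t ^ a * (1 - t) ^ b = ∑ i ∈ Finset.range (a + b + 1), P.coeff i * t ^ i := by
    intro t
    rw [← Polynomial.eval_eq_sum_range' hdeg]
    simp [P]
  simp_rw [this]
  rw [Finset.sum_comm]
  apply Finset.sum_eq_zero
  intro i hi
  rw [← Finset.mul_sum, FiniteField.sum_pow_lt_card_sub_one, mul_zero]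
  have := Finset.mem_range.1 hi
  omega

end MT

namespace MT
open NumberField Pointwise

section
variable {p : ℕ} [Fact p.Prime] {K : Type*} [Field K] [NumberField K] [IsCyclotomicExtension {p} ℚ K]

lemma jac1 {ζ : 𝓞 K} (hζ : IsPrimitiveRoot ζ p) {F : Type*} [Field F] [Fintype F] (f : 𝓞 K →+* F)
    (hf : IsPrimitiveRoot (f ζ) p) {i j : ZMod p} (hi : i ≠ 0) (hj : j ≠ 0) (hij : i + j ≠ 0) :
    ∃ J : 𝓞 K, J * (gal p K (-1) • J) = (Fintype.card F : ℕ) ∧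
      ∀ c ∈ TT p i j, f (gal p K c • J) = 0 := by
  classical
  have hp : p.Prime := Fact.out
  obtain ⟨χ, n0, hn0, hn0pos, hχp, hχf, hχ1⟩ := exists_char hp f hζ hf
  have hχpow : ∀ a : ℕ, χ ^ (a % p) = χ ^ a := by
    intro a
    ext u
    rw [MulChar.pow_apply_coe, MulChar.pow_apply_coe, ← pow_eq_pow_mod a (hχp u u.ne_zero)]
  have hA : ∀ c : (ZMod p)ˣ, gal p K c • jacobiSum (χ ^ i.val) (χ ^ j.val) =
      jacobiSum (χ ^ ((c : ZMod p) * i).val) (χ ^ ((c : ZMod p) * j).val) := by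
    intro c
    have hB : ∀ a : ZMod p, (χ ^ a.val).ringHomComp
        (MulSemiringAction.toRingHom Gal(K/ℚ) (𝓞 K) (gal p K c)) =
        χ ^ ((c : ZMod p) * a).val := by
      intro a
      rw [ZMod.val_mul, hχpow]
      ext u
      have hz : (χ u) ^ p = 1 := hχp u u.ne_zero
      rw [MulChar.ringHomComp_apply, MulChar.pow_apply_coe, MulChar.pow_apply_coe,
        MulSemiringAction.toRingHom_apply, smul_pow', gal_smul c hz, pow_mul]
    rw [← hB, ← hB, jacobiSum_ringHomComp]
    rfl
  have hne : ∀ a : ZMod p, a ≠ 0 → χ ^ a.val ≠ 1 := by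
    intro a ha
    apply hχ1
    intro h
    have h1 := ZMod.val_lt a
    have h2 : 0 < a.val := Nat.pos_of_ne_zero (by rwa [Ne, ZMod.val_eq_zero])
    have := Nat.le_of_dvd h2 h
    omega
  refine ⟨jacobiSum (χ ^ i.val) (χ ^ j.val), ?_, ?_⟩
  · rw [hA]
    have hinv : ∀ a : ZMod p, χ ^ (((-1 : (ZMod p)ˣ) : ZMod p) * a).val = (χ ^ a.val)⁻¹ := by
      intro a
      rw [eq_inv_iff_mul_eq_one, ← pow_add, ← hχpow, ← ZMod.val_add]
      simp
    rw [hinv, hinv]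
    have hinj : Function.Injective (algebraMap (𝓞 K) K) := FaithfulSMul.algebraMap_injective _ _
    apply hinj
    rw [map_mul, ← jacobiSum_ringHomComp, ← jacobiSum_ringHomComp, ← MulChar.ringHomComp_inv,
      ← MulChar.ringHomComp_inv, jacobiSum_mul_jacobiSum_inv, map_natCast]
    · rw [ringChar.eq_zero]
      exact (CharP.ringChar_ne_zero_of_finite F).symm
    · exact (MulChar.ringHomComp_ne_one_iff hinj).2 (hne i hi)
    · exact (MulChar.ringHomComp_ne_one_iff hinj).2 (hne j hj)
    · rw [← MulChar.ringHomComp_mul]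
      refine (MulChar.ringHomComp_ne_one_iff hinj).2 ?_
      rw [← pow_add, ← hχpow, ← ZMod.val_add]
      exact hne _ hij
  · intro c hc
    rw [mem_TT] at hc
    rw [hA]
    have hv : ∀ a : ZMod p, a ≠ 0 → ((c : ZMod p) * a).val ≠ 0 := by
      intro a ha
      rw [Ne, ZMod.val_eq_zero]
      exact mul_ne_zero c.ne_zero ha
    rw [jacobiSum, map_sum]
    have : ∀ t : F, f ((χ ^ ((c : ZMod p) * i).val) t * (χ ^ ((c : ZMod p) * j).val) (1 - t)) =
        t ^ (n0 * ((c : ZMod p) * i).val) * (1 - t) ^ (n0 * ((c : ZMod p) * j).val) := by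
      intro t
      rw [map_mul, MulChar.pow_apply' _ (hv i hi), MulChar.pow_apply' _ (hv j hj), map_pow, map_pow,
        hχf, hχf, pow_mul, pow_mul]
    simp_rw [this]
    apply sum_zero
    rw [← mul_add, ← hn0, mul_comm p]
    exact Nat.mul_lt_mul_of_pos_left hc hn0pos

lemma gal_inv_smul_assoc {ζ : 𝓞 K} (hζ : IsPrimitiveRoot ζ p) {c d : (ZMod p)ˣ} (hcd : c ≠ d) :
    Associated (ζ - 1) ((gal p K c) • ζ - (gal p K d) • ζ) := by
  have hp : p.Prime := Fact.out
  refine hζ.nthRootsFinset_pairwise_associated_sub_one_sub_of_prime hp ?_ ?_ ?_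
  · simp only [Finset.mem_coe]
    rw [Polynomial.mem_nthRootsFinset hp.pos, ← smul_pow', hζ.pow_eq_one, smul_one]
  · simp only [Finset.mem_coe]
    rw [Polynomial.mem_nthRootsFinset hp.pos, ← smul_pow', hζ.pow_eq_one, smul_one]
  · rw [gal_smul c hζ.pow_eq_one, gal_smul d hζ.pow_eq_one]
    intro h
    have := hζ.pow_inj (ZMod.val_lt _) (ZMod.val_lt _) h
    exact hcd (Units.ext (ZMod.val_injective p this))

lemma absNorm_natCast (n : ℕ) : Ideal.absNorm (Ideal.span {(n : 𝓞 K)}) = n ^ (p - 1) := by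
  rw [Ideal.absNorm_span_singleton, ← map_natCast (algebraMap ℤ (𝓞 K)), Algebra.norm_algebraMap,
    RingOfIntegers.rank, IsCyclotomicExtension.finrank K (Polynomial.cyclotomic.irreducible_rat
      (NeZero.pos p)), Nat.totient_prime Fact.out, Int.natAbs_pow, Int.natAbs_natCast]

lemma jac {ζ : 𝓞 K} (hζ : IsPrimitiveRoot ζ p) (P : Ideal (𝓞 K)) (hPp : P.IsPrime) (hP : P ≠ ⊥)
    (x : ℤ) (hx : ζ - x ∈ P) (hpP : (p : 𝓞 K) ∉ P)
    {i j : ZMod p} (hi : i ≠ 0) (hj : j ≠ 0) (hij : i + j ≠ 0) :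
    ∃ J : 𝓞 K, ∃ n : ℕ, 0 < n ∧ J * (gal p K (-1) • J) = n ∧
      Ideal.span {J} = ∏ c ∈ TT p i j, (gal p K c)⁻¹ • P := by
  classical
  have hp : p.Prime := Fact.out
  have hmax : P.IsMaximal := hPp.isMaximal hP
  let _ : Field (𝓞 K ⧸ P) := Ideal.Quotient.field P
  have hfin : Finite (𝓞 K ⧸ P) := Ideal.finiteQuotientOfFreeOfNeBot P hP
  let _ : Fintype (𝓞 K ⧸ P) := Fintype.ofFinite _
  have hdvd : (ζ - 1) ∣ (p : 𝓞 K) := hζ.sub_one_dvd_natCast hp.one_lt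
  have hz1 : ζ - 1 ∉ P := fun h => hpP (P.mem_of_dvd hdvd h)
  have hf : IsPrimitiveRoot (Ideal.Quotient.mk P ζ) p := by
    have h1 : (Ideal.Quotient.mk P ζ) ^ p = 1 := by
      rw [← map_pow, hζ.pow_eq_one, map_one]
    have h2 : Ideal.Quotient.mk P ζ ≠ 1 := by
      intro h
      apply hz1
      rw [← Ideal.Quotient.eq_zero_iff_mem, map_sub, h, map_one, sub_self]
    rw [IsPrimitiveRoot.iff_orderOf]
    exact orderOf_eq_prime h1 h2
  obtain ⟨J, hJ1, hJ2⟩ := jac1 hζ (Ideal.Quotient.mk P) hf hi hj hij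
  have hN : Ideal.absNorm P = Fintype.card (𝓞 K ⧸ P) := by
    rw [Ideal.absNorm_apply, Submodule.cardQuot_apply, Nat.card_eq_fintype_card]
  refine ⟨J, Fintype.card (𝓞 K ⧸ P), Fintype.card_pos, hJ1, ?_⟩
  have hmaxg : ∀ g : Gal(K/ℚ), (g • P).IsMaximal := by
    intro g
    rw [Ideal.pointwise_smul_def]
    exact Ideal.map_isMaximal_of_equiv (MulSemiringAction.toRingEquiv Gal(K/ℚ) (𝓞 K) g)
  have hdiv : ∏ c ∈ TT p i j, (gal p K c)⁻¹ • P ∣ Ideal.span {J} := by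
    apply Finset.prod_dvd_of_coprime
    · intro c _ d _ hcd
      have h1 := hmaxg (gal p K c)⁻¹
      have h2 := hmaxg (gal p K d)⁻¹
      refine Ideal.isCoprime_of_isMaximal ?_
      intro h
      have h3 : (gal p K c)⁻¹ • (ζ - (x : 𝓞 K)) ∈ (gal p K c)⁻¹ • P :=
        Ideal.smul_mem_pointwise_smul _ _ _ hx
      have h4 : (gal p K d)⁻¹ • (ζ - (x : 𝓞 K)) ∈ (gal p K d)⁻¹ • P :=
        Ideal.smul_mem_pointwise_smul _ _ _ hx
      rw [← (show (gal p K c)⁻¹ • P = (gal p K d)⁻¹ • P from h)] at h4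
      have h5 := Ideal.sub_mem _ h3 h4
      rw [smul_sub, smul_sub, smul_intCast', smul_intCast', sub_sub_sub_cancel_right,
        ← map_inv, ← map_inv] at h5
      have h6 := gal_inv_smul_assoc (K := K) hζ (c := c⁻¹) (d := d⁻¹) (by simpa using hcd)
      have h7 := Ideal.mem_of_dvd _ (h6.symm.dvd.trans hdvd) h5
      rw [map_inv, Ideal.mem_inv_pointwise_smul_iff, smul_natCast'] at h7
      exact hpP h7
    · intro c hc
      rw [Ideal.dvd_span_singleton, Ideal.mem_inv_pointwise_smul_iff]
      exact Ideal.Quotient.eq_zero_iff_mem.1 (hJ2 c hc)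
  symm
  obtain ⟨C, hC⟩ := hdiv
  have hJn : Ideal.absNorm (Ideal.span {J}) ^ 2 = Fintype.card (𝓞 K ⧸ P) ^ (p - 1) := by
    rw [← absNorm_natCast (p := p) (K := K), ← hJ1, ← Ideal.span_singleton_mul_span_singleton, map_mul, ← smul_span,
      absNorm_smul, sq]
  have hTn : Ideal.absNorm (∏ c ∈ TT p i j, (gal p K c)⁻¹ • P) ^ 2 =
      Fintype.card (𝓞 K ⧸ P) ^ (p - 1) := by
    rw [map_prod]
    simp_rw [absNorm_smul]
    rw [Finset.prod_const, hN, ← pow_mul, mul_comm, TT_card hi hj hij]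
  have hC1 : Ideal.absNorm C = 1 := by
    rw [hC, map_mul, mul_pow, hTn] at hJn
    have h0 : 0 < Fintype.card (𝓞 K ⧸ P) ^ (p - 1) := pow_pos Fintype.card_pos _
    have := Nat.eq_of_mul_eq_mul_left h0 (hJn.trans (mul_one _).symm)
    simpa using this
  rw [Ideal.absNorm_eq_one_iff] at hC1
  rw [hC, hC1, Ideal.mul_top]
end
end MT

namespace MT
open NumberField Pointwise

section
variable {p : ℕ} [Fact p.Prime] {K : Type*} [Field K] [NumberField K] [IsCyclotomicExtension {p} ℚ K]

lemma multi {ζ : 𝓞 K} (hζ : IsPrimitiveRoot ζ p)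
    (x : ℤ) {i j : ZMod p} (hi : i ≠ 0) (hj : j ≠ 0) (hij : i + j ≠ 0) (A : Ideal (𝓞 K)) :
    A ≠ 0 → (∀ P : Ideal (𝓞 K), P.IsPrime → A ≤ P → ζ - x ∈ P ∧ (p : 𝓞 K) ∉ P) →
    ∃ J : 𝓞 K, ∃ n : ℕ, 0 < n ∧ J * (gal p K (-1) • J) = n ∧
      Ideal.span {J} = ∏ c ∈ TT p i j, (gal p K c)⁻¹ • A := by
  classical
  refine UniqueFactorizationMonoid.induction_on_prime A ?_ ?_ ?_
  · intro h; exact absurd rfl h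
  · intro A hA _ _
    rw [Ideal.isUnit_iff] at hA
    rw [hA, ← Ideal.one_eq_top]
    refine ⟨1, 1, one_pos, by simp, ?_⟩
    rw [Ideal.span_singleton_one, ← Ideal.one_eq_top]
    symm
    exact Finset.prod_eq_one (fun c _ => smul_one _)
  · intro A P hA hP ih _ h
    have hPp : P.IsPrime := Ideal.isPrime_of_prime hP
    obtain ⟨J1, n1, hn1, hJ1, hs1⟩ := ih hA (fun Q hQ hAQ => h Q hQ (Ideal.mul_le_right.trans hAQ))
    obtain ⟨h1, h2⟩ := h P hPp Ideal.mul_le_left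
    obtain ⟨J2, n2, hn2, hJ2, hs2⟩ := jac hζ P hPp hP.ne_zero x h1 h2 hi hj hij
    refine ⟨J1 * J2, n1 * n2, Nat.mul_pos hn1 hn2, ?_, ?_⟩
    · rw [smul_mul', mul_mul_mul_comm, hJ1, hJ2, Nat.cast_mul]
    · rw [← Ideal.span_singleton_mul_span_singleton, hs1, hs2, ← Finset.prod_mul_distrib]
      refine Finset.prod_congr rfl fun c _ => ?_
      rw [smul_mul', mul_comm]

lemma prod_all {ζ : 𝓞 K} (hζ : IsPrimitiveRoot ζ p) (x : 𝓞 K) :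
    ∏ c, (x - gal p K c • ζ) = ∑ i ∈ Finset.range p, x ^ i := by
  have hp : p.Prime := Fact.out
  have h1 := Polynomial.cyclotomic_eq_prod_X_sub_primitiveRoots hζ
  have h2 := congrArg (Polynomial.eval x) h1
  rw [Polynomial.cyclotomic_prime, Polynomial.eval_geom_sum, Polynomial.eval_prod] at h2
  rw [h2]
  refine Finset.prod_bij (fun c _ => gal p K c • ζ) ?_ ?_ ?_ ?_
  · intro c _
    rw [mem_primitiveRoots hp.pos, gal_smul c hζ.pow_eq_one, hζ.pow_iff_coprime hp.pos]
    exact ZMod.val_coe_unit_coprime c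
  · intro a _ b _ h
    rw [gal_smul a hζ.pow_eq_one, gal_smul b hζ.pow_eq_one] at h
    have := hζ.pow_inj (ZMod.val_lt _) (ZMod.val_lt _) h
    exact (Units.ext (ZMod.val_injective p this))
  · intro b hb
    rw [mem_primitiveRoots hp.pos, hζ.isPrimitiveRoot_iff] at hb
    obtain ⟨k, hk, hkp, rfl⟩ := hb
    refine ⟨ZMod.unitOfCoprime k hkp, Finset.mem_univ _, ?_⟩
    rw [gal_smul _ hζ.pow_eq_one]
    simp [ZMod.val_natCast, Nat.mod_eq_of_lt hk]
  · intro a _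
    simp

lemma prod_all_inv {ζ : 𝓞 K} (hζ : IsPrimitiveRoot ζ p) (x : 𝓞 K) :
    ∏ c, (x - (gal p K c)⁻¹ • ζ) = ∑ i ∈ Finset.range p, x ^ i := by
  rw [← prod_all hζ]
  rw [← Equiv.prod_comp (Equiv.inv _)]
  simp

lemma conj_emb (φ : K →+* ℂ) (a : K) :
    φ (gal p K (-1) a) = (starRingEnd ℂ) (φ a) := by
  have hp : p.Prime := Fact.out
  obtain ⟨ζ, hζ⟩ := IsCyclotomicExtension.exists_isPrimitiveRoot ℚ K (S := {p}) (Set.mem_singleton p) hp.ne_zero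
  let pb := hζ.powerBasis ℚ
  let f1 : K →ₐ[ℚ] ℂ := (φ.toRatAlgHom).comp (gal p K (-1)).toAlgHom
  let f2 : K →ₐ[ℚ] ℂ := ((starRingEnd ℂ).comp φ).toRatAlgHom
  have h : f1 = f2 := by
    apply pb.algHom_ext
    have hg : pb.gen = ζ := hζ.powerBasis_gen ℚ
    rw [hg]
    change φ (gal p K (-1) ζ) = (starRingEnd ℂ) (φ ζ)
    rw [gal_apply _ hζ.pow_eq_one]
    have h1 : ‖φ ζ‖ = 1 := by
      refine Complex.norm_eq_one_of_pow_eq_one (n := p) ?_ hp.ne_zero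
      rw [← map_pow, hζ.pow_eq_one, map_one]
    have h2 : φ ζ ≠ 0 := by
      intro h; rw [h] at h1; simp at h1
    have h3 : φ ζ * (starRingEnd ℂ) (φ ζ) = 1 := by
      rw [Complex.mul_conj, Complex.normSq_eq_norm_sq, h1]; simp
    apply mul_left_cancel₀ h2
    rw [h3, ← map_mul, ← pow_succ']
    have h4 : (((-1 : (ZMod p)ˣ) : ZMod p).val + 1) = p := by
      have : NeZero (1 : ZMod p) := inferInstance
      rw [Units.val_neg, Units.val_one, ZMod.val_neg_of_ne_zero, ZMod.val_one]
      have := hp.two_le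
      omega
    rw [h4, hζ.pow_eq_one, map_one]
  exact DFunLike.congr_fun h a

lemma root_unity {ζ : 𝓞 K} (hζ : IsPrimitiveRoot ζ p) (hp2 : 2 < p) (q : ℕ) (hq : Nat.Coprime q (2 * p)) (u : 𝓞 K)
    (hu : u * (gal p K (-1) • u) = 1) : ∃ ρ : 𝓞 K, u = ρ ^ q ∧ ρ * (gal p K (-1) • ρ) = 1 := by
  have hp : p.Prime := Fact.out
  have hint : IsIntegral ℤ (u : K) := RingOfIntegers.isIntegral_coe u
  have hn : ∀ φ : K →+* ℂ, ‖φ (u : K)‖ = 1 := by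
    intro φ
    have h1 : (u : K) * gal p K (-1) (u : K) = 1 := by
      have := congrArg (algebraMap (𝓞 K) K) hu
      rw [map_mul, map_one] at this
      exact this
    have h2 := congrArg φ h1
    rw [map_mul, conj_emb, map_one, Complex.mul_conj, Complex.normSq_eq_norm_sq] at h2
    have h3 : ‖φ (u : K)‖ ^ 2 = 1 := by exact_mod_cast h2
    have := norm_nonneg (φ (u : K))
    nlinarith
  obtain ⟨n, hn0, hn1⟩ := NumberField.Embeddings.pow_eq_one_of_norm_eq_one K ℂ hint hn
  have hζK : IsPrimitiveRoot (ζ : K) p := hζ.map_of_injective (f := algebraMap (𝓞 K) K) (FaithfulSMul.algebraMap_injective _ _)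
  have hfo : IsOfFinOrder (u : K) := isOfFinOrder_iff_pow_eq_one.2 ⟨n, hn0, hn1⟩
  have hodd : Odd p := hp.odd_of_ne_two (by omega)
  obtain ⟨r, hr⟩ := hζK.exists_neg_pow_of_isOfFinOrder hodd hfo
  have hu2 : u ^ (2 * p) = 1 := by
    apply RingOfIntegers.ext
    have : (u : K) ^ (2 * p) = 1 := by
      have h : (-(ζ : K)) ^ (2 * p) = 1 := by
        rw [pow_mul, neg_sq, ← pow_mul, mul_comm, pow_mul, hζK.pow_eq_one, one_pow]
      rw [hr, ← pow_mul, mul_comm r, pow_mul, h, one_pow]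
    simpa using this
  obtain ⟨s, hs⟩ : ∃ s : ℕ, q * s ≡ 1 [MOD (2 * p)] := by
    obtain ⟨s, hs⟩ := Nat.exists_mul_mod_eq_one_of_coprime hq (by omega)
    exact ⟨s, by rw [Nat.ModEq, hs.2]; symm; exact Nat.mod_eq_of_lt (by omega)⟩
  refine ⟨u ^ s, ?_, ?_⟩
  · rw [← pow_mul, pow_eq_pow_mod _ hu2, mul_comm, hs, ← pow_eq_pow_mod _ hu2, pow_one]
  · rw [smul_pow', ← mul_pow, hu, one_pow]
end
end MT

namespace MT
open NumberField Pointwise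

section
variable {p : ℕ} [Fact p.Prime] {K : Type*} [Field K] [NumberField K] [IsCyclotomicExtension {p} ℚ K]

lemma one_sub_assoc {ζ : 𝓞 K} (hζ : IsPrimitiveRoot ζ p) (c : (ZMod p)ˣ) :
    Associated (ζ - 1) (1 - (gal p K c)⁻¹ • ζ) := by
  have hp : p.Prime := Fact.out
  rw [← map_inv]
  refine hζ.nthRootsFinset_pairwise_associated_sub_one_sub_of_prime hp ?_ ?_ ?_
  · simp only [Finset.mem_coe]
    rw [Polynomial.mem_nthRootsFinset hp.pos, one_pow]
  · simp only [Finset.mem_coe]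
    rw [Polynomial.mem_nthRootsFinset hp.pos, ← smul_pow', hζ.pow_eq_one, smul_one]
  · rw [gal_smul _ hζ.pow_eq_one]
    intro h
    have := hζ.pow_inj (i := 0) hp.pos (ZMod.val_lt _) (by rw [pow_zero]; exact h)
    exact (c⁻¹).ne_zero ((ZMod.val_eq_zero _).1 this.symm)

lemma neg_gal (c : (ZMod p)ˣ) : gal p K (-1) * (gal p K c)⁻¹ = (gal p K (-c))⁻¹ := by
  rw [← map_inv, ← map_inv, ← map_mul]
  congr 1
  simp

lemma beta_facts {ζ : 𝓞 K} (hζ : IsPrimitiveRoot ζ p) {x v : ℤ} {q : ℕ}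
    (hsum : ∑ i ∈ Finset.range p, x ^ i = p * v ^ q) (hdvd : (p : ℤ) ∣ x - 1) :
    ∃ β : 𝓞 K, (∀ c, (x : 𝓞 K) - (gal p K c)⁻¹ • ζ =
      (1 - (gal p K c)⁻¹ • ζ) * ((gal p K c)⁻¹ • β)) ∧
      ∏ c, (gal p K c)⁻¹ • β = (v : 𝓞 K) ^ q ∧
      ∀ c d : (ZMod p)ˣ, c ≠ d → IsCoprime ((gal p K c)⁻¹ • β) ((gal p K d)⁻¹ • β) := by
  have hp : p.Prime := Fact.out
  have hz0 : ζ - 1 ≠ 0 := sub_ne_zero.2 (hζ.ne_one hp.one_lt)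
  have h1 : (ζ - 1) ∣ (x : 𝓞 K) - ζ := by
    have h2 : (ζ - 1) ∣ ((x - 1 : ℤ) : 𝓞 K) := by
      refine (hζ.sub_one_dvd_natCast hp.one_lt).trans ?_
      obtain ⟨m, hm⟩ := hdvd
      exact ⟨m, by rw [hm]; push_cast; ring⟩
    have h3 : (x : 𝓞 K) - ζ = ((x - 1 : ℤ) : 𝓞 K) - (ζ - 1) := by push_cast; ring
    rw [h3]
    exact dvd_sub h2 dvd_rfl
  obtain ⟨b, hb⟩ := h1
  have hβ : ∀ c, (x : 𝓞 K) - (gal p K c)⁻¹ • ζ =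
      (1 - (gal p K c)⁻¹ • ζ) * ((gal p K c)⁻¹ • (-b)) := by
    intro c
    have := congrArg (fun z => (gal p K c)⁻¹ • z) hb
    simp only [smul_sub, smul_mul', smul_one, smul_intCast'] at this
    rw [this, smul_neg]
    ring
  refine ⟨-b, hβ, ?_, ?_⟩
  · have h2 := prod_all_inv hζ (x : 𝓞 K)
    have h3 := prod_all_inv hζ (1 : 𝓞 K)
    simp_rw [hβ] at h2
    rw [Finset.prod_mul_distrib, h3] at h2
    have h4 : ∑ i ∈ Finset.range p, (x : 𝓞 K) ^ i = (p : 𝓞 K) * (v : 𝓞 K) ^ q := by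
      have := congrArg (fun z : ℤ => (z : 𝓞 K)) hsum
      push_cast at this
      exact this
    rw [h4] at h2
    simp only [one_pow, Finset.sum_const, Finset.card_range, nsmul_eq_mul, mul_one] at h2
    have hp0 : (p : 𝓞 K) ≠ 0 := by exact_mod_cast hp.ne_zero
    exact mul_left_cancel₀ hp0 h2
  · intro c d hcd
    obtain ⟨u, hu⟩ := one_sub_assoc (K := K) hζ c
    obtain ⟨u', hu'⟩ := one_sub_assoc (K := K) hζ d
    obtain ⟨w, hw⟩ := gal_inv_smul_assoc (K := K) hζ (c := c⁻¹) (d := d⁻¹) (by simpa using hcd)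
    rw [map_inv, map_inv] at hw
    have e1 := hβ c
    have e2 := hβ d
    rw [← hu] at e1
    rw [← hu'] at e2
    have e3 : (ζ - 1) * (u' * ((gal p K d)⁻¹ • (-b)) - u * ((gal p K c)⁻¹ • (-b))) = (ζ - 1) * w := by
      rw [hw]
      linear_combination e1 - e2
    have e4 := mul_left_cancel₀ hz0 e3
    have e5 : (w : 𝓞 K) * (↑w⁻¹ : 𝓞 K) = 1 := Units.mul_inv w
    exact ⟨-u * (↑w⁻¹ : 𝓞 K), u' * (↑w⁻¹ : 𝓞 K), by linear_combination (↑w⁻¹ : 𝓞 K) * e4 + e5⟩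

lemma conj_prod (x : 𝓞 K) (hx : gal p K (-1) • x = x) (ζ : 𝓞 K) {i j : ZMod p} (hi : i ≠ 0) (hj : j ≠ 0)
    (hij : i + j ≠ 0) :
    (∏ c ∈ TT p i j, (x - (gal p K c)⁻¹ • ζ)) *
    (gal p K (-1) • (∏ c ∈ TT p i j, (x - (gal p K c)⁻¹ • ζ))) = ∏ c, (x - (gal p K c)⁻¹ • ζ) := by
  rw [← TT_compl_prod hi hj hij, smul_prod'']
  congr 1
  refine Finset.prod_congr rfl fun c _ => ?_
  rw [smul_sub, hx, smul_smul, neg_gal]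

/-- the fixed factor -/
noncomputable def DD (ζ : 𝓞 K) : 𝓞 K := ∏ c ∈ TT p 1 1, (1 - (gal p K c)⁻¹ • ζ)

lemma main_alg {ζ : 𝓞 K} (hζ : IsPrimitiveRoot ζ p) (hp2 : 2 < p) {q : ℕ} (hq : Nat.Coprime q (2 * p))
    (hq0 : q ≠ 0) {x : ℤ} {v : ℕ}
    (hsum : ∑ i ∈ Finset.range p, x ^ i = p * (v : ℤ) ^ q) (hdvd : (p : ℤ) ∣ x - 1)
    (hv : 0 < v) (hpv : IsCoprime (p : ℤ) v)
    {i j : ZMod p} (hi : i ≠ 0) (hj : j ≠ 0) (hij : i + j ≠ 0) :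
    ∃ α : 𝓞 K, ∏ c ∈ TT p i j, ((x : 𝓞 K) - (gal p K c)⁻¹ • ζ) = DD (p := p) ζ * α ^ q ∧
      α * (gal p K (-1) • α) = v := by
  classical
  have hp : p.Prime := Fact.out
  obtain ⟨β, hβ, hprod, hcop⟩ := beta_facts (K := K) hζ hsum hdvd
  have hv0 : ((v : ℤ) : 𝓞 K) ≠ 0 := by exact_mod_cast hv.ne'
  have hβ0 : β ≠ 0 := by
    intro h
    rw [h] at hprod
    simp only [smul_zero] at hprod
    rw [Finset.prod_eq_zero (Finset.mem_univ 1) rfl] at hprod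
    exact pow_ne_zero q hv0 hprod.symm
  have hI : ∏ c : (ZMod p)ˣ, Ideal.span {(gal p K c)⁻¹ • β} = Ideal.span {((v : ℤ) : 𝓞 K)} ^ q := by
    rw [Ideal.prod_span_singleton, hprod, Ideal.span_singleton_pow]
  obtain ⟨A, hA⟩ : ∃ A : Ideal (𝓞 K), Ideal.span {β} = A ^ q := by
    obtain ⟨A, hA⟩ := Finset.exists_eq_pow_of_mul_eq_pow_of_coprime (s := Finset.univ) (f := fun c : (ZMod p)ˣ => Ideal.span {(gal p K c)⁻¹ • β}) (fun c _ d _ hcd => by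
      rw [Ideal.isCoprime_span_singleton_iff]
      exact hcop c d hcd) hI 1 (Finset.mem_univ 1)
    refine ⟨A, ?_⟩
    rw [← hA]
    simp
  have hβprod : (β : 𝓞 K) ∣ (v : 𝓞 K) ^ q := by
    have := Finset.dvd_prod_of_mem (fun c : (ZMod p)ˣ => (gal p K c)⁻¹ • β) (Finset.mem_univ 1)
    rw [hprod] at this
    simpa using this
  obtain ⟨J, n, hn, hJ, hspan⟩ := multi hζ x hi hj hij A (by
      intro h
      rw [h, zero_pow hq0] at hA
      exact hβ0 (Ideal.span_singleton_eq_bot.1 hA)) (by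
      intro P hP hAP
      have hβP : β ∈ P := by
        have h1 : Ideal.span {β} ≤ A := by rw [hA]; exact Ideal.pow_le_self hq0
        exact hAP (h1 (Ideal.mem_span_singleton_self β))
      constructor
      · have h2 := hβ 1
        rw [map_one, inv_one, one_smul, one_smul] at h2
        have h3 : ζ - x = β * (-(1 - ζ)) := by linear_combination -h2
        rw [h3]
        exact P.mul_mem_right _ hβP
      · intro hpP
        have h3 : (v : 𝓞 K) ∈ P := hP.mem_of_pow_mem q (P.mem_of_dvd hβprod hβP)
        obtain ⟨a, b, hab⟩ := hpv
        have h4 : (a : 𝓞 K) * p + b * v = 1 := by exact_mod_cast congrArg (fun z : ℤ => (z : 𝓞 K)) hab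
        apply hP.ne_top
        rw [Ideal.eq_top_iff_one, ← h4]
        exact P.add_mem (P.mul_mem_left _ hpP) (P.mul_mem_left _ h3))
  have hspanq : Ideal.span {J} ^ q = ∏ c ∈ TT p i j, Ideal.span {(gal p K c)⁻¹ • β} := by
    rw [hspan, ← Finset.prod_pow]
    refine Finset.prod_congr rfl fun c _ => ?_
    rw [← smul_pow', ← hA, smul_span]
  have hnv : n = v := by
    have h1 : Ideal.span {(n : 𝓞 K)} ^ q = Ideal.span {(v : 𝓞 K)} ^ q := by
      rw [← hJ, ← Ideal.span_singleton_mul_span_singleton, ← smul_span, mul_pow, ← smul_pow', hspanq]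
      rw [Finset.smul_prod']
      simp_rw [smul_span, smul_smul, neg_gal]
      rw [TT_compl_prod hi hj hij (fun c => Ideal.span {(gal p K c)⁻¹ • β}), hI]
      simp
    have h2 := congrArg Ideal.absNorm h1
    rw [map_pow, map_pow, absNorm_natCast (p := p), absNorm_natCast (p := p), ← pow_mul, ← pow_mul] at h2
    exact Nat.pow_left_injective (Nat.mul_ne_zero (by omega) hq0) h2
  subst hnv
  have hassoc : Associated (DD (p := p) ζ * J ^ q) (∏ c ∈ TT p i j, ((x : 𝓞 K) - (gal p K c)⁻¹ • ζ)) := by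
    simp_rw [hβ]
    rw [Finset.prod_mul_distrib]
    refine Associated.mul_mul ?_ ?_
    · have h12 : (1 : ZMod p) + 1 ≠ 0 := by
        intro h
        have : ((2 : ℕ) : ZMod p) = 0 := by push_cast; rw [← h]; norm_num
        rw [ZMod.natCast_eq_zero_iff] at this
        have := Nat.le_of_dvd (by norm_num) this
        omega
      have hk : ∀ (i j : ZMod p), i ≠ 0 → j ≠ 0 → i + j ≠ 0 →
          Associated ((ζ - 1) ^ ((p - 1) / 2)) (∏ c ∈ TT p i j, (1 - (gal p K c)⁻¹ • ζ)) := by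
        intro i j hi hj hij
        have h1 := TT_card hi hj hij
        rw [show (p - 1) / 2 = (TT p i j).card by omega, ← Finset.prod_const]
        exact Associated.prod _ _ _ (fun c _ => one_sub_assoc hζ c)
      exact (hk 1 1 one_ne_zero one_ne_zero h12).symm.trans (hk i j hi hj hij)
    · rw [← Ideal.span_singleton_eq_span_singleton, ← Ideal.prod_span_singleton, ← hspanq,
        Ideal.span_singleton_pow]
  obtain ⟨u, hu⟩ := hassoc
  have h12 : (1 : ZMod p) + 1 ≠ 0 := by
    intro h
    have : ((2 : ℕ) : ZMod p) = 0 := by push_cast; rw [← h]; norm_num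
    rw [ZMod.natCast_eq_zero_iff] at this
    have := Nat.le_of_dvd (by norm_num) this
    omega
  have hDD := conj_prod (K := K) (1 : 𝓞 K) (smul_one _) ζ (i := 1) (j := 1) one_ne_zero one_ne_zero h12
  have hWW := conj_prod (K := K) (x : 𝓞 K) (smul_intCast' _ _) ζ hi hj hij
  rw [prod_all_inv hζ] at hDD hWW
  have h4 : ∑ i ∈ Finset.range p, (x : 𝓞 K) ^ i = (p : 𝓞 K) * (n : 𝓞 K) ^ q := by
    have := congrArg (fun z : ℤ => (z : 𝓞 K)) hsum
    push_cast at this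
    exact this
  rw [h4, ← hu] at hWW
  simp only [one_pow, Finset.sum_const, Finset.card_range, nsmul_eq_mul, mul_one] at hDD
  change DD (p := p) ζ * (gal p K (-1) • DD (p := p) ζ) = p at hDD
  have hp0 : (p : 𝓞 K) ≠ 0 := by exact_mod_cast hp.ne_zero
  have hn0 : (n : 𝓞 K) ^ q ≠ 0 := pow_ne_zero _ (by exact_mod_cast hn.ne')
  have huu : (u : 𝓞 K) * (gal p K (-1) • (u : 𝓞 K)) = 1 := by
    rw [smul_mul', smul_mul', smul_pow'] at hWW
    apply mul_left_cancel₀ (mul_ne_zero hp0 hn0)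
    rw [mul_one]
    nth_rw 1 [← hDD, ← hJ]
    rw [mul_pow]
    linear_combination hWW
  obtain ⟨ρ, hρ, hρ1⟩ := root_unity hζ hp2 q hq (u : 𝓞 K) huu
  refine ⟨ρ * J, ?_, ?_⟩
  · rw [← hu, hρ]; ring
  · rw [smul_mul', mul_mul_mul_comm, hρ1, hJ, one_mul]
end
end MT

namespace MT
open NumberField Pointwise

lemma prodf {R ι : Type*} [CommRing R] [Fintype ι] [DecidableEq ι] {n : ℕ} (T : Fin n → Finset ι)
    (X : ι → R) (D : R) (α : Fin n → R) (q : ℕ) (h : ∀ s, ∏ c ∈ T s, X c = D * α s ^ q)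
    (f : Fin n → ℕ) :
    ∏ c, X c ^ (∑ s, if c ∈ T s then f s else 0) = D ^ (∑ s, f s) * (∏ s, α s ^ f s) ^ q := by
  have h1 : ∀ s, (D * α s ^ q) ^ f s = ∏ c, X c ^ (if c ∈ T s then f s else 0) := by
    intro s
    rw [← h, ← Finset.prod_pow]
    rw [← Finset.prod_subset (Finset.subset_univ (T s))]
    · refine Finset.prod_congr rfl fun c hc => ?_
      rw [if_pos hc]
    · intro c _ hc
      rw [if_neg hc, pow_zero]
  have h2 : ∏ s, (D * α s ^ q) ^ f s = D ^ (∑ s, f s) * (∏ s, α s ^ f s) ^ q := by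
    rw [← Finset.prod_pow_eq_pow_sum, ← Finset.prod_pow, ← Finset.prod_mul_distrib]
    refine Finset.prod_congr rfl fun c hc => ?_
    rw [mul_pow, ← pow_mul, ← pow_mul, mul_comm q]
  rw [← h2]
  simp_rw [h1]
  rw [Finset.prod_comm]
  refine Finset.prod_congr rfl fun c hc => ?_
  rw [Finset.prod_pow_eq_pow_sum]

lemma sumf {ι : Type*} [Fintype ι] [DecidableEq ι] {n r : ℕ} (T : Fin n → Finset ι)
    (hT : ∀ s, (T s).card = r) (f : Fin n → ℕ) :
    ∑ c, (∑ s, if c ∈ T s then f s else 0) = r * ∑ s, f s := by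
  rw [Finset.sum_comm, Finset.mul_sum]
  refine Finset.sum_congr rfl fun s _ => ?_
  rw [← Finset.sum_filter]
  simp [hT]

lemma exp_le {R ι : Type*} [CommRing R] [IsDomain R] [Fintype ι] [DecidableEq ι] (b : ι → R)
    (hc : ∀ c d, c ≠ d → IsCoprime (b c) (b d)) (h0 : ∀ c, b c ≠ 0) (hu : ∀ c, ¬ IsUnit (b c))
    (m m' : ι → ℕ) (h : ∏ c, b c ^ m c ∣ ∏ c, b c ^ m' c) (c : ι) : m c ≤ m' c := by
  have h1 : b c ^ m c ∣ ∏ c, b c ^ m' c :=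
    (Finset.dvd_prod_of_mem (fun c => b c ^ m c) (Finset.mem_univ c)).trans h
  rw [← Finset.mul_prod_erase _ _ (Finset.mem_univ c)] at h1
  have h2 : IsCoprime (b c ^ m c) (∏ d ∈ Finset.univ.erase c, b d ^ m' d) := by
    apply IsCoprime.prod_right
    intro d hd
    exact (hc c d (Finset.ne_of_mem_erase hd).symm).pow
  have h3 := h2.dvd_of_dvd_mul_right h1
  exact (pow_dvd_pow_iff (h0 c) (hu c)).1 h3

lemma root_approx {ι : Type*} [Fintype ι] (w : ι → ℂ) (hw : ∀ c, ‖w c‖ = 1) (x : ℝ) (hx : 2 ≤ |x|)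
    (m : ι → ℕ) (q : ℕ) (hq : 0 < q) (hm : 20 * ∑ c, m c ≤ 3 * q) :
    ∃ E : ℂ, E ^ q = ∏ c, (1 - w c / x) ^ m c ∧ ‖E - 1‖ ≤ 1 / (2 * |x|) := by
  have hx0 : 0 < |x| := by linarith
  have hz : ∀ c, ‖-(w c / (x : ℂ))‖ = 1 / |x| := by
    intro c
    rw [norm_neg, norm_div, hw, Complex.norm_real, Real.norm_eq_abs]
  have hhalf : 1 / |x| ≤ 1 / 2 := one_div_le_one_div_of_le (by norm_num) hx
  have hL : ∀ c, ‖Complex.log (1 - w c / x)‖ ≤ 3 / 2 * (1 / |x|) := by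
    intro c
    have := Complex.norm_log_one_add_half_le_self (z := -(w c / (x : ℂ))) (by rw [hz]; exact hhalf)
    rwa [hz, ← sub_eq_add_neg] at this
  have hne : ∀ c, 1 - w c / x ≠ 0 := by
    intro c h
    have h1 : w c / (x : ℂ) = 1 := (sub_eq_zero.1 h).symm
    have h2 := hz c
    rw [h1] at h2
    simp only [norm_neg, norm_one] at h2
    linarith
  have hq0 : (q : ℂ) ≠ 0 := by exact_mod_cast hq.ne'
  have hqR : (0 : ℝ) < q := by exact_mod_cast hq
  set s : ℂ := (∑ c, (m c : ℂ) * Complex.log (1 - w c / x)) / q with hs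
  have hsn : ‖s‖ ≤ 1 / (4 * |x|) := by
    rw [hs, norm_div, Complex.norm_natCast, div_le_iff₀ hqR]
    have h1 : ‖∑ c, (m c : ℂ) * Complex.log (1 - w c / x)‖ ≤ ∑ c, (m c : ℝ) * (3 / 2 * (1 / |x|)) := by
      refine norm_sum_le_of_le _ fun c _ => ?_
      rw [norm_mul, Complex.norm_natCast]
      exact mul_le_mul_of_nonneg_left (hL c) (Nat.cast_nonneg _)
    rw [← Finset.sum_mul] at h1
    have h2 : (20 : ℝ) * ∑ c, (m c : ℝ) ≤ 3 * q := by exact_mod_cast hm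
    have h3 : 1 / (4 * |x|) * q = (q / 4) * (1 / |x|) := by field_simp
    rw [h3]
    refine h1.trans ?_
    have h4 : 0 ≤ 1 / |x| := by positivity
    nlinarith
  refine ⟨Complex.exp s, ?_, ?_⟩
  · rw [← Complex.exp_nat_mul, hs, mul_div_cancel₀ _ hq0, Complex.exp_sum]
    refine Finset.prod_congr rfl fun c _ => ?_
    rw [Complex.exp_nat_mul, Complex.exp_log (hne c)]
  · have h1 : 1 / (4 * |x|) ≤ 1 := by
      rw [div_le_one (by positivity)]; linarith
    refine (Complex.norm_exp_sub_one_le (hsn.trans h1)).trans ?_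
    have h3 : 1 / (2 * |x|) = 2 * (1 / (4 * |x|)) := by field_simp; norm_num
    rw [h3]
    linarith

section
variable {p : ℕ} [Fact p.Prime] {K : Type*} [Field K] [NumberField K] [IsCyclotomicExtension {p} ℚ K]

lemma norm_ge (φ : K →+* ℂ) (δ : 𝓞 K) (hδ : δ ≠ 0) :
    1 ≤ ∏ c : (ZMod p)ˣ, ‖φ (gal p K c (δ : K))‖ := by
  have hG : IsGalois ℚ K := IsCyclotomicExtension.isGalois {p} ℚ K
  have h1 := Algebra.norm_eq_prod_automorphisms ℚ (δ : K)
  have h2 : ∏ c : (ZMod p)ˣ, gal p K c (δ : K) = ∏ σ : Gal(K/ℚ), σ (δ : K) :=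
    Function.Bijective.prod_comp (gal_bij (p := p) (K := K)) (fun σ => σ (δ : K))
  rw [← norm_prod, ← map_prod, h2, ← h1]
  rw [← Algebra.coe_norm_int]
  simp only [map_intCast, Complex.norm_intCast]
  have h3 : Algebra.norm ℤ δ ≠ 0 := Algebra.norm_ne_zero_iff.2 hδ
  exact_mod_cast Int.one_le_abs h3

lemma norm_of_conj (φ : K →+* ℂ) (α : 𝓞 K) (v : ℕ) (h : α * (gal p K (-1) • α) = v)
    (c : (ZMod p)ˣ) : ‖φ (gal p K c (α : K))‖ ^ 2 = v := by
  have h1 := congrArg (algebraMap (𝓞 K) K) h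
  rw [map_mul, map_natCast] at h1
  change (α : K) * gal p K (-1) (α : K) = v at h1
  have h2 := conj_emb (p := p) (φ.comp (gal p K c : K →+* K)) (α : K)
  have h3 := congrArg (φ.comp (gal p K c : K →+* K)) h1
  rw [map_mul, h2, Complex.mul_conj, map_natCast, Complex.normSq_eq_norm_sq] at h3
  exact_mod_cast h3
end
end MT

namespace MT
open NumberField Pointwise

lemma x_big {p q : ℕ} (hp11 : 11 ≤ p) (hpq : 4 * p ^ 2 ≤ q) {x : ℤ} (hd : (p : ℤ) ^ (q - 1) ∣ x - 1)
    (hx1 : x ≠ 1) : 4 ^ p < x.natAbs := by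
  have h1 : p ^ (q - 1) ≤ (x - 1).natAbs := by
    apply Nat.le_of_dvd
    · rw [Int.natAbs_pos]; omega
    · have := Int.natAbs_dvd_natAbs.2 hd
      rwa [Int.natAbs_pow, Int.natAbs_natCast] at this
  have h2 : 4 ^ (p + 1) ≤ p ^ (q - 1) := by
    refine (Nat.pow_le_pow_left (by omega : 4 ≤ p) _).trans ?_
    apply Nat.pow_le_pow_right (by omega)
    have : p + 2 ≤ 4 * p ^ 2 := by nlinarith
    omega
  have h3 : 1 < 4 ^ p := Nat.one_lt_pow (by omega) (by norm_num)
  rw [pow_succ] at h2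
  omega

lemma v_ne_one {p q : ℕ} (hp11 : 11 ≤ p) {x : ℤ} {v : ℕ} (hx : 4 ^ p < x.natAbs)
    (hsum : ∑ i ∈ Finset.range p, x ^ i = p * (v : ℤ) ^ q) : v ≠ 1 := by
  rintro rfl
  have h1 := geom_sum_mul x p
  rw [hsum] at h1
  simp only [Nat.cast_one, one_pow, mul_one] at h1
  have h2 : |x| ^ 2 ≤ |x| ^ p := by
    apply pow_le_pow_right₀ _ (by omega)
    rw [Int.abs_eq_natAbs]
    have : 0 < 4 ^ p := by positivity
    omega
  have hxx : (4 : ℤ) ^ p < |x| := by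
    rw [Int.abs_eq_natAbs]; exact_mod_cast hx
  have h3 : |x| ^ p ≤ p * (|x| + 1) + 1 := by
    rw [← abs_pow, show x ^ p = p * (x - 1) + 1 by linarith]
    refine (abs_add_le _ _).trans ?_
    rw [abs_mul, abs_one, Nat.abs_cast]
    gcongr
    refine (abs_sub _ _).trans ?_
    simp
  have h4 : (p : ℤ) + p + 2 < 4 ^ p := by
    have : 1 + p * 3 ≤ 4 ^ p := by
      have := one_add_mul_le_pow (a := (3 : ℤ)) (by norm_num) p
      norm_num at this
      exact_mod_cast this
    zify at this
    have : (11 : ℤ) ≤ p := by exact_mod_cast hp11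
    linarith
  nlinarith

lemma v_le {p q : ℕ} (hp : 0 < p) {x : ℤ} {v : ℕ} (hx : 4 ^ p < x.natAbs)
    (hsum : ∑ i ∈ Finset.range p, x ^ i = p * (v : ℤ) ^ q) : v ^ q ≤ x.natAbs ^ (p - 1) := by
  have h0 : (1 : ℤ) ≤ |x| := by
    rw [Int.abs_eq_natAbs]
    have : 0 < 4 ^ p := by positivity
    omega
  have h1 : ∑ i ∈ Finset.range p, x ^ i ≤ ∑ i ∈ Finset.range p, |x| ^ (p - 1) := by
    refine Finset.sum_le_sum fun i hi => ?_
    have := Finset.mem_range.1 hi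
    refine (le_abs_self _).trans ?_
    rw [abs_pow]
    exact pow_le_pow_right₀ h0 (by omega)
  rw [hsum, Finset.sum_const, Finset.card_range, nsmul_eq_mul] at h1
  have h2 : (v : ℤ) ^ q ≤ |x| ^ (p - 1) := le_of_mul_le_mul_left h1 (by exact_mod_cast hp)
  rw [Int.abs_eq_natAbs] at h2
  exact_mod_cast h2

section
variable {p : ℕ} [Fact p.Prime] {K : Type*} [Field K] [NumberField K] [IsCyclotomicExtension {p} ℚ K]

lemma inj_aux {ζ : 𝓞 K} (hζ : IsPrimitiveRoot ζ p) {q : ℕ} {x : ℤ} {v : ℕ} (hq0 : q ≠ 0)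
    (hsum : ∑ i ∈ Finset.range p, x ^ i = p * (v : ℤ) ^ q) (hdvd : (p : ℤ) ∣ x - 1)
    (hv : 0 < v) (hv1 : v ≠ 1) (hp2 : 2 < p) (m m' : (ZMod p)ˣ → ℕ) (hmm : ∑ c, m c = ∑ c, m' c)
    (h : ∏ c, ((x : 𝓞 K) - (gal p K c)⁻¹ • ζ) ^ m c = ∏ c, ((x : 𝓞 K) - (gal p K c)⁻¹ • ζ) ^ m' c) :
    ∀ c, m c = m' c := by
  classical
  have hp : p.Prime := Fact.out
  obtain ⟨β, hβ, hprod, hcop⟩ := beta_facts (K := K) hζ hsum hdvd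
  have hv0 : ((v : ℤ) : 𝓞 K) ≠ 0 := by exact_mod_cast hv.ne'
  have hβ0 : ∀ c, (gal p K c)⁻¹ • β ≠ 0 := by
    intro c h
    rw [Finset.prod_eq_zero (Finset.mem_univ c) h] at hprod
    exact pow_ne_zero q hv0 hprod.symm
  have hz0 : ζ - 1 ≠ 0 := sub_ne_zero.2 (hζ.ne_one hp.one_lt)
  have hβu : ∀ c, ¬ IsUnit ((gal p K c)⁻¹ • β) := by
    intro c hc
    have h1 : ∀ d, IsUnit ((gal p K d)⁻¹ • β) := by
      intro d
      have := hc.map (MulSemiringAction.toRingHom Gal(K/ℚ) (𝓞 K) ((gal p K d)⁻¹ * (gal p K c)))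
      rw [MulSemiringAction.toRingHom_apply, smul_smul] at this
      simpa using this
    have h2 : IsUnit (∏ c, (gal p K c)⁻¹ • β) := by
      rw [IsUnit.prod_univ_iff]; exact h1
    rw [hprod, isUnit_pow_iff hq0] at h2
    have h3 := absNorm_natCast (p := p) (K := K) v
    rw [Ideal.span_singleton_eq_top.2 (by simpa using h2), Ideal.absNorm_top] at h3
    have h4 := (Nat.pow_eq_one).1 h3.symm
    rcases h4 with h4 | h4
    · exact hv1 h4
    · omega
  have hA : ∀ m : (ZMod p)ˣ → ℕ,
      Associated (∏ c, ((x : 𝓞 K) - (gal p K c)⁻¹ • ζ) ^ m c)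
        ((ζ - 1) ^ (∑ c, m c) * ∏ c, ((gal p K c)⁻¹ • β) ^ m c) := by
    intro m
    rw [← Finset.prod_pow_eq_pow_sum, ← Finset.prod_mul_distrib]
    refine Associated.prod _ _ _ fun c _ => ?_
    rw [← mul_pow, hβ]
    exact Associated.pow_pow (Associated.mul_right (one_sub_assoc hζ c).symm _)
  have hB := (hA m).symm.trans ((Associated.of_eq h).trans (hA m'))
  rw [hmm] at hB
  have hC := hB.of_mul_left (Associated.refl _) (pow_ne_zero _ hz0)
  intro c
  exact le_antisymm (exp_le _ hcop hβ0 hβu m m' hC.dvd c) (exp_le _ hcop hβ0 hβu m' m hC.symm.dvd c)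

end
end MT

namespace MT
open NumberField Pointwise


section
variable {p : ℕ} [Fact p.Prime] {K : Type*} [Field K] [NumberField K] [IsCyclotomicExtension {p} ℚ K]

lemma core {ζ : 𝓞 K} (hζ : IsPrimitiveRoot ζ p) (hp11 : 11 ≤ p) {q : ℕ} (hpq : 4 * p ^ 2 ≤ q)
    (hq : Nat.Coprime q (2 * p)) {x : ℤ} {v : ℕ}
    (hsum : ∑ i ∈ Finset.range p, x ^ i = p * (v : ℤ) ^ q) (hd : (p : ℤ) ^ (q - 1) ∣ x - 1)
    (hx1 : x ≠ 1) (hv : 0 < v) (hpv : IsCoprime (p : ℤ) v) : False := by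
  classical
  have hp : p.Prime := Fact.out
  have hp2 : 2 < p := by omega
  have hq1 : 1 < q := by nlinarith
  have hq0 : q ≠ 0 := by omega
  have hdvd : (p : ℤ) ∣ x - 1 := (dvd_pow_self _ (by omega)).trans hd
  have hxb := x_big hp11 hpq hd hx1
  have hv1 := v_ne_one hp11 hxb hsum
  have hvx := v_le hp.pos hxb hsum
  obtain ⟨n, I, L, pos, hgood, hpos1, hpos2, hcard⟩ := family p hp11
  have hmain := fun s => main_alg (K := K) hζ hp2 hq hq0 hsum hdvd hv hpv
    (hgood s).1 (hgood s).2.1 (hgood s).2.2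
  choose α hα hαv using hmain
  obtain ⟨k, hk⟩ : ∃ k, k = 3 * q / (p - 1) ^ 2 := ⟨_, rfl⟩
  have hpp : 0 < (p - 1) ^ 2 := pow_pos (by omega) 2
  have hk1 : k * (p - 1) ^ 2 ≤ 3 * q := by rw [hk]; exact Nat.div_mul_le_self _ _
  have hk2 : 3 * q < (k + 1) * (p - 1) ^ 2 := by
    rw [hk, mul_comm (3 * q / (p - 1) ^ 2 + 1)]; exact Nat.lt_mul_div_succ _ hpp
  have hk12 : 12 ≤ k := by
    rw [hk, Nat.le_div_iff_mul_le hpp]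
    have : (p - 1) ^ 2 ≤ p ^ 2 := Nat.pow_le_pow_left (by omega) 2
    omega
  have hcard2 : q < Fintype.card (Sym (Fin n) k) := by
    rw [Sym.card_sym_eq_choose, Fintype.card_fin]
    have := hcard k hk12
    omega
  let T : Fin n → Finset (ZMod p)ˣ := fun s => TT p (I s) (L s)
  let f : Sym (Fin n) k → Fin n → ℕ := fun m => (Sym.equivNatSumOfFintype (Fin n) k m).1
  have hf : ∀ m, ∑ s, f m s = k := fun m => (Sym.equivNatSumOfFintype (Fin n) k m).2
  have hfinj : ∀ m m', f m = f m' → m = m' := by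
    intro m m' h
    exact (Sym.equivNatSumOfFintype (Fin n) k).injective (Subtype.ext h)
  let N : Sym (Fin n) k → (ZMod p)ˣ → ℕ := fun m c => ∑ s, if c ∈ T s then f m s else 0
  let a : Sym (Fin n) k → 𝓞 K := fun m => ∏ s, α s ^ f m s
  have hNsum : ∀ m, ∑ c, N m c = (p - 1) / 2 * k := by
    intro m
    have := sumf T (r := (p - 1) / 2) (fun s => by
      have := TT_card (hgood s).1 (hgood s).2.1 (hgood s).2.2
      change (TT p (I s) (L s)).card = _
      omega) (f m)
    rw [hf] at this
    exact this
  have hprod : ∀ m, ∏ c, ((x : 𝓞 K) - (gal p K c)⁻¹ • ζ) ^ N m c = DD (p := p) ζ ^ k * a m ^ q := by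
    intro m
    have := prodf T (fun c => (x : 𝓞 K) - (gal p K c)⁻¹ • ζ) (DD (p := p) ζ) α q hα (f m)
    rw [hf] at this
    exact this
  have hconj : ∀ m, a m * (gal p K (-1) • a m) = ((v ^ k : ℕ) : 𝓞 K) := by
    intro m
    rw [smul_prod'', ← Finset.prod_mul_distrib]
    simp_rw [smul_pow', ← mul_pow, hαv]
    rw [Finset.prod_pow_eq_pow_sum, hf, Nat.cast_pow]
  have hainj : ∀ m m', a m = a m' → m = m' := by
    intro m m' h
    have h1 := inj_aux (K := K) hζ hq0 hsum hdvd hv hv1 hp2 (N m) (N m')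
      (by rw [hNsum, hNsum]) (by rw [hprod, hprod, h])
    exact hfinj m m' (family_inj T pos hpos1 hpos2 (f m) (f m') h1)
  obtain ⟨φ⟩ : Nonempty (K →+* ℂ) := inferInstance
  let w : (ZMod p)ˣ → ℂ := fun c => φ (((gal p K c)⁻¹ • ζ : 𝓞 K) : K)
  have hw : ∀ c, ‖w c‖ = 1 := by
    intro c
    refine Complex.norm_eq_one_of_pow_eq_one (n := p) ?_ hp.ne_zero
    have h1 : ((gal p K c)⁻¹ • ζ) ^ p = 1 := by rw [← smul_pow', hζ.pow_eq_one, smul_one]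
    have h2 := congrArg (fun z : 𝓞 K => φ (algebraMap (𝓞 K) K z)) h1
    simp only [map_pow, map_one] at h2
    exact h2
  have hxR : (4 : ℝ) ^ p < |(x : ℝ)| := by
    have : ((x.natAbs : ℕ) : ℝ) = |(x : ℝ)| := by rw [Nat.cast_natAbs, Int.cast_abs]
    rw [← this]
    exact_mod_cast hxb
  have h4p : (2 : ℝ) ≤ 4 ^ p := by
    have : (4 : ℝ) ^ 1 ≤ 4 ^ p := pow_le_pow_right₀ (by norm_num) (by omega)
    linarith
  have hx2 : 2 ≤ |(x : ℝ)| := by linarith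
  have hX0 : 0 < |(x : ℝ)| := by linarith
  have hxC : (((x : ℝ) : ℂ)) ≠ 0 := by
    have : (x : ℝ) ≠ 0 := abs_pos.1 hX0
    exact_mod_cast this
  have hE := fun m => root_approx w hw (x : ℝ) hx2 (N m) q (by omega) (by
    rw [hNsum]
    have h1 : 10 * (k * (p - 1)) ≤ 3 * q := by
      refine le_trans ?_ hk1
      have : 10 ≤ p - 1 := by omega
      nlinarith [Nat.zero_le k, Nat.mul_le_mul_left (k * (p - 1)) this]
    have h2 : 2 * ((p - 1) / 2) ≤ p - 1 := Nat.mul_div_le _ _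
    nlinarith [Nat.mul_le_mul_left k h2])
  choose E hE1 hE2 using hE
  have hD0 : φ (DD (p := p) ζ : K) ≠ 0 := by
    have hz0 : ζ - 1 ≠ 0 := sub_ne_zero.2 (hζ.ne_one hp.one_lt)
    have : DD (p := p) ζ ≠ 0 := by
      rw [DD, Finset.prod_ne_zero_iff]
      intro c _
      exact (one_sub_assoc hζ c).ne_zero_iff.1 hz0
    rw [Ne, map_eq_zero]
    exact_mod_cast this
  have hEn : ∀ m, 1 / 2 ≤ ‖E m‖ := by
    intro m
    have h1 : 1 / (2 * |(x : ℝ)|) ≤ 1 / 2 := by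
      apply one_div_le_one_div_of_le <;> linarith
    have h2 := norm_sub_norm_le (1 : ℂ) (1 - E m)
    rw [norm_one, norm_sub_rev, sub_sub_cancel] at h2
    have := hE2 m
    linarith
  have hE0 : ∀ m, E m ≠ 0 := by
    intro m h
    have := hEn m
    rw [h, norm_zero] at this
    norm_num at this
  let C : ℂ := ((x : ℝ) : ℂ) ^ ((p - 1) / 2 * k) / φ (DD (p := p) ζ : K) ^ k
  have hy : ∀ m, (φ (a m : K) / E m) ^ q = C := by
    intro m
    have h1 := congrArg (fun z : 𝓞 K => φ (algebraMap (𝓞 K) K z)) (hprod m)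
    simp only [map_prod, map_pow, map_mul, map_sub, map_intCast] at h1
    have h2 : ∏ c, ((x : ℂ) - w c) ^ N m c = ((x : ℝ) : ℂ) ^ ((p - 1) / 2 * k) * E m ^ q := by
      rw [hE1, ← hNsum m, ← Finset.prod_pow_eq_pow_sum, ← Finset.prod_mul_distrib]
      refine Finset.prod_congr rfl fun c _ => ?_
      rw [← mul_pow, mul_sub, mul_one, mul_div_cancel₀ _ hxC, Complex.ofReal_intCast]
    have h3 : ((x : ℝ) : ℂ) ^ ((p - 1) / 2 * k) * E m ^ q = φ (DD (p := p) ζ : K) ^ k * φ (a m : K) ^ q :=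
      h2.symm.trans h1
    rw [div_pow, div_eq_div_iff (pow_ne_zero _ (hE0 m)) (pow_ne_zero _ hD0), h3]
    ring
  obtain ⟨m, _, m', _, hmm, hyy⟩ := Finset.exists_ne_map_eq_of_card_lt_of_maps_to
    (s := (Finset.univ : Finset (Sym (Fin n) k))) (t := (Polynomial.nthRoots q C).toFinset)
    (f := fun m => φ (a m : K) / E m) (by
      rw [Finset.card_univ]
      exact lt_of_le_of_lt ((Multiset.toFinset_card_le _).trans (Polynomial.card_nthRoots q C)) hcard2)
    (by
      intro m _
      rw [Finset.mem_coe, Multiset.mem_toFinset, Polynomial.mem_nthRoots (by omega)]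
      exact hy m)
  have hδ : a m - a m' ≠ 0 := fun h => hmm (hainj _ _ (sub_eq_zero.1 h))
  have hnorm := norm_ge (p := p) φ (a m - a m') hδ
  obtain ⟨B, hB0, hB⟩ : ∃ B : ℝ, 0 ≤ B ∧ B ^ 2 = ((v ^ k : ℕ) : ℝ) :=
    ⟨Real.sqrt ((v ^ k : ℕ) : ℝ), Real.sqrt_nonneg _, Real.sq_sqrt (Nat.cast_nonneg _)⟩
  have hanorm : ∀ m c, ‖φ (gal p K c (a m : K))‖ = B := by
    intro m c
    have := norm_of_conj φ (a m) _ (hconj m) c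
    rw [← hB] at this
    exact (pow_left_inj₀ (norm_nonneg _) hB0 two_ne_zero).1 this
  have hsub : ((a m - a m' : 𝓞 K) : K) = (a m : K) - (a m' : K) := map_sub (algebraMap (𝓞 K) K) _ _
  have hall : ∀ c : (ZMod p)ˣ, ‖φ (gal p K c ((a m - a m' : 𝓞 K) : K))‖ ≤ 2 * B := by
    intro c
    rw [hsub, map_sub, map_sub]
    refine (norm_sub_le _ _).trans ?_
    rw [hanorm, hanorm]
    linarith
  have h1 : ‖φ ((a m - a m' : 𝓞 K) : K)‖ ≤ 2 * B / |(x : ℝ)| := by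
    have e1 : φ (a m : K) = φ (a m : K) / E m * E m := (div_mul_cancel₀ _ (hE0 m)).symm
    have e2 : φ (a m' : K) = φ (a m : K) / E m * E m' := by
      rw [show φ (a m : K) / E m = φ (a m' : K) / E m' from hyy, div_mul_cancel₀ _ (hE0 m')]
    have e3 : φ ((a m - a m' : 𝓞 K) : K) = φ (a m : K) / E m * (E m - E m') := by
      rw [hsub, map_sub, mul_sub, ← e1, ← e2]
    have e4 : ‖φ (a m : K)‖ = B := by
      have := hanorm m 1
      rwa [map_one] at this
    have e5 : ‖E m - E m'‖ ≤ 1 / |(x : ℝ)| := by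
      have : E m - E m' = (E m - 1) - (E m' - 1) := by ring
      rw [this]
      refine (norm_sub_le _ _).trans ?_
      have e6 : 1 / |(x : ℝ)| = 1 / (2 * |(x : ℝ)|) + 1 / (2 * |(x : ℝ)|) := by field_simp; norm_num
      rw [e6]
      exact add_le_add (hE2 m) (hE2 m')
    rw [e3, norm_mul, norm_div, e4]
    have e7 : B / ‖E m‖ ≤ 2 * B := by
      rw [div_le_iff₀ (by have := hEn m; linarith)]
      nlinarith [hEn m]
    calc B / ‖E m‖ * ‖E m - E m'‖ ≤ 2 * B * (1 / |(x : ℝ)|) := by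
          apply mul_le_mul e7 e5 (norm_nonneg _) (by linarith)
      _ = _ := by ring
  have h1' : ‖φ (gal p K 1 ((a m - a m' : 𝓞 K) : K))‖ ≤ 2 * B / |(x : ℝ)| := by
    rw [map_one]; exact h1
  have h2 : ‖φ (gal p K (-1) ((a m - a m' : 𝓞 K) : K))‖ ≤ 2 * B / |(x : ℝ)| := by
    rw [conj_emb, RCLike.norm_conj]; exact h1
  have hne : (-1 : (ZMod p)ˣ) ≠ 1 := by
    intro h
    have h3 := congrArg (fun u : (ZMod p)ˣ => (u : ZMod p)) h
    simp only [Units.val_neg, Units.val_one] at h3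
    have : Fact (2 < p) := ⟨hp2⟩
    exact ZMod.neg_one_ne_one h3
  have hcardU : (Finset.univ : Finset (ZMod p)ˣ).card = p - 1 := by
    rw [Finset.card_univ, ZMod.card_units_eq_totient, Nat.totient_prime hp]
  have hub : ∏ c : (ZMod p)ˣ, ‖φ (gal p K c ((a m - a m' : 𝓞 K) : K))‖ ≤
      (2 * B) ^ (p - 1) / |(x : ℝ)| ^ 2 := by
    rw [← Finset.mul_prod_erase _ _ (Finset.mem_univ (1 : (ZMod p)ˣ)),
      ← Finset.mul_prod_erase _ _ (Finset.mem_erase.2 ⟨hne, Finset.mem_univ (-1 : (ZMod p)ˣ)⟩)]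
    have h3 : ∏ c ∈ (Finset.univ.erase (1 : (ZMod p)ˣ)).erase (-1),
        ‖φ (gal p K c ((a m - a m' : 𝓞 K) : K))‖ ≤ (2 * B) ^ (p - 3) := by
      refine (Finset.prod_le_prod (fun _ _ => norm_nonneg _) (fun c _ => hall c)).trans ?_
      rw [Finset.prod_const,Finset.card_erase_of_mem (Finset.mem_erase.2 ⟨hne, Finset.mem_univ _⟩),
        Finset.card_erase_of_mem (Finset.mem_univ _), hcardU]
      exact le_of_eq rfl
    have h4 : (2 * B) ^ (p - 1) / |(x : ℝ)| ^ 2 =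
        (2 * B / |(x : ℝ)|) * ((2 * B / |(x : ℝ)|) * (2 * B) ^ (p - 3)) := by
      rw [show p - 1 = (p - 3) + 2 by omega, pow_add]
      field_simp
    rw [h4]
    have h5 : 0 ≤ 2 * B / |(x : ℝ)| := by positivity
    apply mul_le_mul h1' _ _ h5
    · apply mul_le_mul h2 h3 _ h5
      exact Finset.prod_nonneg fun _ _ => norm_nonneg _
    · exact mul_nonneg (norm_nonneg _) (Finset.prod_nonneg fun _ _ => norm_nonneg _)
  have hfin : |(x : ℝ)| ^ 2 ≤ (2 * B) ^ (p - 1) := by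
    have := hnorm.trans hub
    rwa [le_div_iff₀ (by positivity), one_mul] at this
  have hvk : v ^ (k * (p - 1)) ≤ x.natAbs ^ 3 := by
    have h3 : (v ^ (k * (p - 1))) ^ (p - 1) ≤ (x.natAbs ^ 3) ^ (p - 1) := by
      calc (v ^ (k * (p - 1))) ^ (p - 1) = v ^ (k * (p - 1) ^ 2) := by rw [← pow_mul]; ring_nf
        _ ≤ v ^ (3 * q) := Nat.pow_le_pow_right hv hk1
        _ = (v ^ q) ^ 3 := by rw [← pow_mul, mul_comm]
        _ ≤ (x.natAbs ^ (p - 1)) ^ 3 := Nat.pow_le_pow_left hvx 3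
        _ = _ := by rw [← pow_mul, ← pow_mul, mul_comm]
    exact (Nat.pow_le_pow_iff_left (by omega)).1 h3
  have hBp : (B ^ (p - 1)) ^ 2 ≤ |(x : ℝ)| ^ 3 := by
    rw [← pow_mul, mul_comm, pow_mul, hB]
    have : ((x.natAbs : ℕ) : ℝ) = |(x : ℝ)| := by rw [Nat.cast_natAbs, Int.cast_abs]
    rw [← this, ← Nat.cast_pow, ← Nat.cast_pow, ← pow_mul]
    exact_mod_cast hvk
  have h6 : (|(x : ℝ)| ^ 2) ^ 2 ≤ 4 ^ (p - 1) * |(x : ℝ)| ^ 3 := by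
    calc (|(x : ℝ)| ^ 2) ^ 2 ≤ ((2 * B) ^ (p - 1)) ^ 2 := pow_le_pow_left₀ (by positivity) hfin 2
      _ = 4 ^ (p - 1) * (B ^ (p - 1)) ^ 2 := by
          rw [mul_pow, mul_pow, ← pow_mul 2, mul_comm (p - 1) 2, pow_mul 2 2]; norm_num
      _ ≤ _ := by gcongr
  have h7 : |(x : ℝ)| * |(x : ℝ)| ^ 3 ≤ 4 ^ (p - 1) * |(x : ℝ)| ^ 3 := by
    refine le_trans (le_of_eq ?_) h6
    ring
  have h8 := le_of_mul_le_mul_right h7 (by positivity)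
  have h9 : (4 : ℝ) ^ (p - 1) ≤ 4 ^ p := pow_le_pow_right₀ (by norm_num) (by omega)
  linarith
end

lemma half (p q : ℕ) (hp : p.Prime) (hq : q.Prime) (hpq : p ≠ q)
    (hp11 : 11 ≤ p) (hq11 : 11 ≤ q) (x y : ℤ) (hx : x ≠ 0) (hy : y ≠ 0)
    (h : x ^ p - y ^ q = 1) : q < 4 * p ^ 2 := by
  by_contra hcon
  push Not at hcon
  obtain ⟨v, hv, hsum, hcop, hd, hx1⟩ := cassels p q hp hq hp11 hcon x y hx hy h
  lift v to ℕ using hv.le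
  have : Fact p.Prime := ⟨hp⟩
  have hq2 : Nat.Coprime q (2 * p) := by
    apply Nat.Coprime.mul_right
    · exact (Nat.coprime_primes hq Nat.prime_two).2 (by omega)
    · exact (Nat.coprime_primes hq hp).2 hpq.symm
  have hnz0 : NeZero p := ⟨hp.ne_zero⟩
  have hnz : NeZero ((p : ℕ) : ℚ) := ⟨by exact_mod_cast hp.ne_zero⟩
  have hcyc : IsCyclotomicExtension {p} ℚ (CyclotomicField p ℚ) :=
    CyclotomicField.isCyclotomicExtension p ℚ
  have hζ := (IsCyclotomicExtension.zeta_spec p ℚ (CyclotomicField p ℚ)).toInteger_isPrimitiveRoot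
  exact core hζ hp11 hcon hq2 hsum hd hx1 (by exact_mod_cast hv) hcop

end MT

theorem mihailescu_third (p q : ℕ) (hp : p.Prime) (hq : q.Prime) (hpq : p ≠ q)
    (hp11 : 11 ≤ p) (hq11 : 11 ≤ q) (x y : ℤ) (hx : x ≠ 0) (hy : y ≠ 0)
    (h : x ^ p - y ^ q = 1) :
    p < 4 * q ^ 2 ∧ q < 4 * p ^ 2 := by
  refine ⟨MT.half q p hq hp hpq.symm hq11 hp11 (-y) (-x) (neg_ne_zero.2 hy) (neg_ne_zero.2 hx) ?_,
    MT.half p q hp hq hpq hp11 hq11 x y hx hy h⟩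
  rw [(hp.odd_of_ne_two (by omega)).neg_pow, (hq.odd_of_ne_two (by omega)).neg_pow]
  linarith
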